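/- For every k ∈ {0,…,n}, the set {b_S : S ⊆ I, |S| = k, and every fully dotted column x of S satisfies x^S ≠ x} is an A-basis of ker(F) ∩ Λ_A^k; in particular ker(F) ∩ Λ_A^k is a free A-module of rank binom(2n,k) − binom(2n,k−2). -/

import Mathlib

noncomputable section

/-- The field `𝔽 = ℚ(q)`. -/
abbrev Fq : Type := RatFunc ℚ

/-- The quantum parameter `q`. -/
def qv : Fq := RatFunc.X

/-- The index set `I = {1,…,n} ∪ {−n,…,−1}` as a finset of integers. -/
def Iset (n : ℕ) : Finset ℤ := (Finset.Icc (-(n : ℤ)) (n : ℤ)).erase 0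

/-- Subsets of `I`, the index type for the standard basis. -/
abbrev Bset (n : ℕ) : Type := {S : Finset ℤ // S ⊆ Iset n}

/-- `Λ`, the free `𝔽`-vector space with basis `{v_S : S ⊆ I}`. -/
abbrev Lam (n : ℕ) : Type := Bset n →₀ Fq

/-- The standard basis vector `v_S`. -/
def bv (n : ℕ) (S : Bset n) : Lam n := Finsupp.single S 1

/-- The standard basis vector `v_T` for a finset `T ⊆ I` (and `0` for junk input). -/
def vS (n : ℕ) (T : Finset ℤ) : Lam n :=
  if h : T ⊆ Iset n then Finsupp.single (⟨T, h⟩ : Bset n) (1 : Fq) else 0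

/-- The linear operator on `Λ` determined by prescribed values on the standard basis. -/
def mkOp (n : ℕ) (g : Bset n → Lam n) : Module.End Fq (Lam n) :=
  Finsupp.linearCombination Fq g

/-- The four positions `{i, i+1, −i, −(i+1)}`. -/
def quad (i : ℤ) : Finset ℤ := {i, i + 1, -i, -(i + 1)}

/-- Value of `f_i` on `v_S`. -/
def fAct (n : ℕ) (i : ℤ) (S : Finset ℤ) : Lam n :=
  if i = (n : ℤ) then
    (if (n : ℤ) ∈ S ∧ -(n : ℤ) ∉ S then vS n (insert (-(n : ℤ)) (S.erase (n : ℤ))) else 0)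
  else
    (if S ∩ quad i = {i} then vS n (insert (i + 1) (S.erase i))
     else if S ∩ quad i = {-(i + 1)} then vS n (insert (-i) (S.erase (-(i + 1))))
     else if S ∩ quad i = ({i, -(i + 1)} : Finset ℤ) then
       vS n (insert (-i) (S.erase (-(i + 1)))) + qv⁻¹ • vS n (insert (i + 1) (S.erase i))
     else if S ∩ quad i = ({i, -i} : Finset ℤ) then qv • vS n (insert (i + 1) (S.erase i))
     else if S ∩ quad i = ({i + 1, -(i + 1)} : Finset ℤ) then
       vS n (insert (-i) (S.erase (-(i + 1))))
     else if S ∩ quad i = ({i, -(i + 1), -i} : Finset ℤ) then vS n (insert (i + 1) (S.erase i))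
     else if S ∩ quad i = ({i, i + 1, -(i + 1)} : Finset ℤ) then
       vS n (insert (-i) (S.erase (-(i + 1))))
     else 0)

/-- Value of `e_i` on `v_S`. -/
def eAct (n : ℕ) (i : ℤ) (S : Finset ℤ) : Lam n :=
  if i = (n : ℤ) then
    (if -(n : ℤ) ∈ S ∧ (n : ℤ) ∉ S then vS n (insert (n : ℤ) (S.erase (-(n : ℤ)))) else 0)
  else
    (if S ∩ quad i = {-i} then vS n (insert (-(i + 1)) (S.erase (-i)))
     else if S ∩ quad i = {i + 1} then vS n (insert i (S.erase (i + 1)))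
     else if S ∩ quad i = ({i + 1, -i} : Finset ℤ) then
       vS n (insert i (S.erase (i + 1))) + qv⁻¹ • vS n (insert (-(i + 1)) (S.erase (-i)))
     else if S ∩ quad i = ({i, -i} : Finset ℤ) then qv • vS n (insert (-(i + 1)) (S.erase (-i)))
     else if S ∩ quad i = ({i + 1, -(i + 1)} : Finset ℤ) then vS n (insert i (S.erase (i + 1)))
     else if S ∩ quad i = ({i, i + 1, -i} : Finset ℤ) then
       vS n (insert (-(i + 1)) (S.erase (-i)))
     else if S ∩ quad i = ({i + 1, -(i + 1), -i} : Finset ℤ) then vS n (insert i (S.erase (i + 1)))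
     else 0)

/-- Coefficient of `ε_j` in `wt(S)`. -/
def epsCoef (S : Finset ℤ) (j : ℤ) : ℤ :=
  (if j ∈ S then 1 else 0) - (if -j ∈ S then 1 else 0)

/-- The pairing `(α_i, wt S)`. -/
def alphaPair (n : ℕ) (i : ℤ) (S : Finset ℤ) : ℤ :=
  if i = (n : ℤ) then 2 * epsCoef S (n : ℤ) else epsCoef S i - epsCoef S (i + 1)

/-- The operator `f_i` on `Λ`. -/
def fop (n : ℕ) (i : ℤ) : Module.End Fq (Lam n) := mkOp n (fun S => fAct n i S.1)

/-- The operator `e_i` on `Λ`. -/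
def eop (n : ℕ) (i : ℤ) : Module.End Fq (Lam n) := mkOp n (fun S => eAct n i S.1)

/-- The operator `k_i` on `Λ`, `k_i · v_S = q^{(α_i, wt S)} v_S`. -/
def kop (n : ℕ) (i : ℤ) : Module.End Fq (Lam n) :=
  mkOp n (fun S => (qv ^ alphaPair n i S.1) • bv n S)

/-- The operator `k_i⁻¹` on `Λ`. -/
def kinvop (n : ℕ) (i : ℤ) : Module.End Fq (Lam n) :=
  mkOp n (fun S => (qv ^ (-alphaPair n i S.1)) • bv n S)

/-- `−S`. -/
def negSet (S : Finset ℤ) : Finset ℤ := S.image (fun x => -x)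

/-- `S₀ = S ∩ (−S)`, the fully dotted columns. -/
def Szero (S : Finset ℤ) : Finset ℤ := S ∩ negSet S

/-- `S₀^c = (I∖S) ∩ (−(I∖S))`, the undotted columns. -/
def Szeroc (n : ℕ) (S : Finset ℤ) : Finset ℤ := (Iset n \ S) ∩ negSet (Iset n \ S)

/-- `w(S) = (|S₀| − |S₀^c|)/2`. -/
def wTot (n : ℕ) (S : Finset ℤ) : ℤ :=
  (((Szero S).card : ℤ) - ((Szeroc n S).card : ℤ)) / 2

/-- `w_{>i}(S)`. -/
def wGt (n : ℕ) (i : ℤ) (S : Finset ℤ) : ℤ :=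
  ((((Szero S).filter (fun x => i < |x| ∧ |x| ≤ (n : ℤ))).card : ℤ)
    - (((Szeroc n S).filter (fun x => i < |x| ∧ |x| ≤ (n : ℤ))).card : ℤ)) / 2

/-- `w_{<i}(S)`. -/
def wLt (n : ℕ) (i : ℤ) (S : Finset ℤ) : ℤ :=
  ((((Szeroc n S).filter (fun x => x ≠ 0 ∧ |x| < i)).card : ℤ)
    - (((Szero S).filter (fun x => x ≠ 0 ∧ |x| < i)).card : ℤ)) / 2

/-- Value of `E` on `v_S`. -/
def EAct (n : ℕ) (S : Finset ℤ) : Lam n :=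
  ∑ i ∈ (Finset.Icc (1 : ℤ) (n : ℤ)).filter (fun i => i ∈ Szeroc n S ∧ -i ∈ Szeroc n S),
    ((-qv) ^ wGt n i S) • vS n (insert i (insert (-i) S))

/-- Value of `F` on `v_S`. -/
def FAct (n : ℕ) (S : Finset ℤ) : Lam n :=
  ∑ i ∈ (Finset.Icc (1 : ℤ) (n : ℤ)).filter (fun i => i ∈ Szero S ∧ -i ∈ Szero S),
    ((-qv) ^ wLt n i S) • vS n ((S.erase i).erase (-i))

/-- The operator `E` on `Λ`. -/
def Eop (n : ℕ) : Module.End Fq (Lam n) := mkOp n (fun S => EAct n S.1)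

/-- The operator `F` on `Λ`. -/
def Fop (n : ℕ) : Module.End Fq (Lam n) := mkOp n (fun S => FAct n S.1)

/-- The operator `K` on `Λ`, `K · v_S = (−q)^{w(S)} v_S`. -/
def Kop (n : ℕ) : Module.End Fq (Lam n) := mkOp n (fun S => ((-qv) ^ wTot n S.1) • bv n S)

/-- The operator `K⁻¹` on `Λ`. -/
def Kinvop (n : ℕ) : Module.End Fq (Lam n) :=
  mkOp n (fun S => ((-qv) ^ (-wTot n S.1)) • bv n S)

/-- Balanced quantum integer `[m]_x`. -/
def qNum (x : Fq) (m : ℕ) : Fq := (x ^ (m : ℤ) - x ^ (-(m : ℤ))) / (x - x⁻¹)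

/-- Quantum factorial `[m]_x!`. -/
def qFact (x : Fq) (m : ℕ) : Fq := ∏ j ∈ Finset.range m, qNum x (j + 1)

/-- Gaussian binomial coefficient in the variable `x`. -/
def qBinom (x : Fq) (m s : ℕ) : Fq := qFact x m / (qFact x s * qFact x (m - s))

/-- The variable `q_i`: `q` for `i < n` and `q²` for `i = n`. -/
def qsub (n : ℕ) (i : ℤ) : Fq := if i = (n : ℤ) then qv ^ 2 else qv

/-- The subring `A = ℤ[q,q⁻¹] ⊆ 𝔽`. -/
def Asub : Subring Fq := Subring.closure {qv, qv⁻¹}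

/-- The `A`-lattice `Λ_A ⊆ Λ`: the `A`-span of all `v_S`. -/
def LamA (n : ℕ) : Set (Lam n) :=
  {x | ∃ c : Bset n →₀ Fq, (∀ S, c S ∈ Asub) ∧ x = c.sum (fun S a => a • bv n S)}

/-- The degree-`k` part `Λ^k ⊆ Λ`. -/
def Lk (n k : ℕ) : Submodule Fq (Lam n) :=
  Submodule.span Fq {x | ∃ S : Bset n, S.1.card = k ∧ x = bv n S}

/-- The divided power `E^{(m)} = E^m/[m]!`. -/
def Ediv (n : ℕ) (m : ℕ) : Module.End Fq (Lam n) := (qFact qv m)⁻¹ • (Eop n ^ m)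

/-- The divided power `F^{(m)} = F^m/[m]!`. -/
def Fdiv (n : ℕ) (m : ℕ) : Module.End Fq (Lam n) := (qFact qv m)⁻¹ • (Fop n ^ m)

/-- One step of the matching algorithm at column `x`, acting on the pair
(partial assignment, set `U` of unmatched undotted columns). -/
def stepCol (S : Finset ℤ) (x : ℤ) (p : (ℤ → ℤ) × Finset ℤ) : (ℤ → ℤ) × Finset ℤ :=
  if x ∈ S ∧ -x ∈ S then
    (if hU : p.2.Nonempty then
      (Function.update p.1 x (p.2.min' hU), p.2.erase (p.2.min' hU))
     else (Function.update p.1 x x, p.2))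
  else if x ∉ S ∧ -x ∉ S then (p.1, insert x p.2)
  else p

/-- Running the matching algorithm over the columns `n, n−1, …, 1`. -/
def matchData (n : ℕ) (S : Finset ℤ) : (ℤ → ℤ) × Finset ℤ :=
  ((List.range n).map (fun t => (n : ℤ) - t)).foldl (fun p x => stepCol S x p) (id, ∅)

/-- The matching `x ↦ x^S`. -/
def matchCol (n : ℕ) (S : Finset ℤ) (x : ℤ) : ℤ := (matchData n S).1 x

/-- `L(S)`: fully dotted columns matched to an undotted column. -/
def LSet (n : ℕ) (S : Finset ℤ) : Finset ℤ :=
  (Finset.Icc (1 : ℤ) (n : ℤ)).filter (fun x => x ∈ S ∧ -x ∈ S ∧ matchCol n S x ≠ x)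

/-- `±X`. -/
def pmSet (X : Finset ℤ) : Finset ℤ := X ∪ negSet X

/-- The canonical basis vector `b_S`. -/
def bvecL (n : ℕ) (S : Finset ℤ) : Lam n :=
  ∑ X ∈ (LSet n S).powerset,
    (qv ^ (-(X.card : ℤ))) • vS n ((S \ pmSet X) ∪ pmSet (X.image (matchCol n S)))

/-- The index set of the canonical basis of ker(F) ∩ Λ_A^k: subsets S ⊆ I with |S| = k all
of whose fully dotted columns are matched to undotted columns. -/
def goodSets (n k : ℕ) : Finset (Finset ℤ) :=
  (Iset n).powerset.filter
    (fun S => S.card = k ∧ ∀ x ∈ Finset.Icc (1 : ℤ) (n : ℤ), x ∈ S → -x ∈ S → matchCol n S x ≠ x)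

/-- `1` for an undotted column, `-1` for a fully dotted one, `0` otherwise. -/
def colSign (P : Finset ℤ) (j : ℤ) : ℤ :=
  if j ∈ P ∧ -j ∈ P then -1 else if j ∉ P ∧ -j ∉ P then 1 else 0

/-- The number of undotted minus the number of fully dotted columns among `1, …, i`. -/
def colWeight (P : Finset ℤ) (i : ℕ) : ℤ := ∑ j ∈ Finset.range i, colSign P (j + 1)

/-- The number of fully dotted columns among `1, …, n` left over when each of them is paired
with an undotted column to its right, within these columns. -/
def unmatchedCount : ℕ → Finset ℤ → ℕ
  | 0, _ => 0
  | n + 1, P =>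
    if (n + 1 : ℤ) ∈ P ∧ -(n + 1 : ℤ) ∈ P then unmatchedCount n P + 1
    else if (n + 1 : ℤ) ∉ P ∧ -(n + 1 : ℤ) ∉ P then unmatchedCount n P - 1
    else unmatchedCount n P

/-- Fill the column `j`. -/
def fillCol (P : Finset ℤ) (j : ℤ) : Finset ℤ := insert j (insert (-j) P)

lemma mem_fillCol {P : Finset ℤ} {j a : ℤ} : a ∈ fillCol P j ↔ a = j ∨ a = -j ∨ a ∈ P := by
  simp [fillCol]

/-- The part of `F` that removes the column `i + 1`, in terms of coordinate functions. -/
def colLower (i : ℕ) : Module.End Fq (Finset ℤ → Fq) where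
  toFun x P := if (i + 1 : ℤ) ∉ P ∧ -(i + 1 : ℤ) ∉ P then
    (-qv) ^ colWeight P i * x (fillCol P (i + 1)) else 0
  map_add' x y := by
    ext P; simp only [Pi.add_apply]; split_ifs
    · ring
    · simp
  map_smul' c x := by
    ext P; simp only [Pi.smul_apply, smul_eq_mul, RingHom.id_apply]; split_ifs
    · ring
    · simp

lemma colLower_apply (i : ℕ) (x : Finset ℤ → Fq) (P : Finset ℤ) :
    colLower i x P = if (i + 1 : ℤ) ∉ P ∧ -(i + 1 : ℤ) ∉ P then
      (-qv) ^ colWeight P i * x (fillCol P (i + 1)) else 0 := rfl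

/-- The operator `F` on the first `n` columns, in terms of coordinate functions. -/
def lower (n : ℕ) : Module.End Fq (Finset ℤ → Fq) := ∑ i ∈ Finset.range n, colLower i

lemma lower_succ (n : ℕ) : lower (n + 1) = lower n + colLower n := by
  simp [lower, Finset.sum_range_succ]

/-- Truncation of a coordinate function to the sets satisfying `p`. -/
def truncate (p : Finset ℤ → Prop) [DecidablePred p] : Module.End Fq (Finset ℤ → Fq) where
  toFun x P := if p P then x P else 0
  map_add' x y := by ext P; by_cases h : p P <;> simp [h]
  map_smul' c x := by ext P; by_cases h : p P <;> simp [h]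

lemma truncate_apply (p : Finset ℤ → Prop) [DecidablePred p] (x : Finset ℤ → Fq) (P : Finset ℤ) :
    truncate p x P = if p P then x P else 0 := rfl

lemma qv_ne_zero : qv ≠ 0 := RatFunc.X_ne_zero

lemma colSign_fillCol_of_ne {P : Finset ℤ} {i j : ℤ} (h : i ≠ j) (h' : i ≠ -j) :
    colSign (fillCol P j) i = colSign P i := by
  have h1 : -i ≠ j := by omega
  have h2 : -i ≠ -j := by omega
  simp only [colSign, mem_fillCol, h, h', h1, h2, false_or]

lemma colWeight_fillCol_of_le {P : Finset ℤ} {i j : ℕ} (h : i ≤ j) :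
    colWeight (fillCol P (j + 1)) i = colWeight P i := by
  refine Finset.sum_congr rfl fun a ha => ?_
  rw [Finset.mem_range] at ha
  exact colSign_fillCol_of_ne (by omega) (by omega)

lemma colWeight_fillCol_of_lt {P : Finset ℤ} {i j : ℕ} (h : i < j)
    (hi : (i + 1 : ℤ) ∉ P ∧ -(i + 1 : ℤ) ∉ P) :
    colWeight (fillCol P (i + 1)) j = colWeight P j - 2 := by
  have hm : i ∈ Finset.range j := Finset.mem_range.2 h
  unfold colWeight
  rw [← Finset.add_sum_erase _ _ hm, ← Finset.add_sum_erase _ (fun a : ℕ => colSign P (a + 1)) hm,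
    Finset.sum_congr rfl (g := fun a : ℕ => colSign P (a + 1))]
  · have h1 : colSign (fillCol P (i + 1)) (i + 1) = -1 := by simp [colSign, mem_fillCol]
    have h2 : colSign P (i + 1) = 1 := by
      rw [colSign, if_neg (fun h => hi.1 h.1), if_pos hi]
    rw [h1, h2]; ring
  · intro a ha
    rw [Finset.mem_erase] at ha
    exact colSign_fillCol_of_ne (by omega) (by omega)

lemma fillCol_comm (P : Finset ℤ) (i j : ℤ) :
    fillCol (fillCol P i) j = fillCol (fillCol P j) i := by
  ext a; simp only [mem_fillCol]; tauto

lemma colLower_mul_colLower {i j : ℕ} (h : i < j) :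
    colLower j * colLower i = qv ^ 2 • (colLower i * colLower j) := by
  ext x P
  have e1 : ((i + 1 : ℤ) ∉ fillCol P (j + 1) ∧ -(i + 1 : ℤ) ∉ fillCol P (j + 1)) ↔
      ((i + 1 : ℤ) ∉ P ∧ -(i + 1 : ℤ) ∉ P) := by
    simp only [mem_fillCol]
    constructor
    · tauto
    · rintro ⟨h1, h2⟩
      refine ⟨?_, ?_⟩ <;> (rintro (h3 | h3 | h3) <;> first | contradiction | omega)
  have e2 : ((j + 1 : ℤ) ∉ fillCol P (i + 1) ∧ -(j + 1 : ℤ) ∉ fillCol P (i + 1)) ↔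
      ((j + 1 : ℤ) ∉ P ∧ -(j + 1 : ℤ) ∉ P) := by
    simp only [mem_fillCol]
    constructor
    · tauto
    · rintro ⟨h1, h2⟩
      refine ⟨?_, ?_⟩ <;> (rintro (h3 | h3 | h3) <;> first | contradiction | omega)
  simp only [Module.End.mul_apply, LinearMap.smul_apply, Pi.smul_apply, colLower_apply, e1, e2,
    smul_eq_mul]
  by_cases hi : (i + 1 : ℤ) ∉ P ∧ -(i + 1 : ℤ) ∉ P
  · by_cases hj : (j + 1 : ℤ) ∉ P ∧ -(j + 1 : ℤ) ∉ P
    · rw [if_pos hi, if_pos hj, if_pos hi, if_pos hj, colWeight_fillCol_of_le h.le,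
        colWeight_fillCol_of_lt h hi, fillCol_comm, zpow_sub₀ (neg_ne_zero.2 qv_ne_zero)]
      have := qv_ne_zero
      have h2 : (-qv) ^ (2 : ℤ) = qv ^ 2 := by norm_cast; ring
      rw [h2]
      field_simp
    · rw [if_neg hj, if_pos hi, if_neg hj]; simp
  · rw [if_neg hi, if_neg hi]; simp

lemma colLower_mul_self (i : ℕ) : colLower i * colLower i = 0 := by
  ext x P
  simp [Module.End.mul_apply, colLower_apply, mem_fillCol]

lemma colLower_mul_lower (n : ℕ) :
    colLower n * lower n = qv ^ 2 • (lower n * colLower n) := by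
  rw [lower, Finset.mul_sum, Finset.sum_mul, Finset.smul_sum]
  exact Finset.sum_congr rfl fun i hi => colLower_mul_colLower (Finset.mem_range.1 hi)

lemma mul_pow_of_smul_comm {K A : Type*} [CommSemiring K] [Semiring A] [Algebra K A] {r g : A}
    {c : K} (h : g * r = c • (r * g)) (m : ℕ) : g * r ^ m = c ^ m • (r ^ m * g) := by
  induction m with
  | zero => simp
  | succ m ih =>
    rw [pow_succ, ← mul_assoc, ih, smul_mul_assoc, mul_assoc, h, mul_smul_comm, smul_smul,
      ← mul_assoc, ← pow_succ, ← pow_succ]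

/-- The `q`-binomial theorem for `g` with `g ^ 2 = 0`. -/
lemma add_pow_succ_of_smul_comm {K A : Type*} [CommSemiring K] [Semiring A] [Algebra K A] {r g : A}
    {c : K} (h : g * r = c • (r * g)) (hg : g * g = 0) (m : ℕ) :
    (r + g) ^ (m + 1) = r ^ (m + 1) + (∑ b ∈ Finset.range (m + 1), c ^ b) • (r ^ m * g) := by
  induction m with
  | zero => simp
  | succ m ih =>
    rw [pow_succ', ih, add_mul, mul_add, mul_add, mul_pow_of_smul_comm h, mul_smul_comm,
      mul_smul_comm, ← mul_assoc g, mul_pow_of_smul_comm h, smul_mul_assoc, mul_assoc _ g g, hg,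
      Finset.sum_range_succ _ (m + 1), add_smul, ← mul_assoc, ← pow_succ', ← pow_succ']
    simp [add_assoc]

lemma geom_sum_qv_ne_zero (m : ℕ) : (∑ b ∈ Finset.range (m + 1), (qv ^ 2) ^ b) ≠ 0 := by
  have h : (∑ b ∈ Finset.range (m + 1), (qv ^ 2) ^ b) = algebraMap (Polynomial ℚ) Fq
      (∑ b ∈ Finset.range (m + 1), (Polynomial.X ^ 2) ^ b) := by
    simp [qv]
  rw [h]
  refine RatFunc.algebraMap_ne_zero fun h0 => ?_
  have := congrArg (Polynomial.eval 1) h0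
  simp [Polynomial.eval_finsetSum] at this
  norm_cast at this

lemma unmatchedCount_congr {n : ℕ} {P Q : Finset ℤ}
    (h : ∀ a : ℤ, a ≠ 0 → |a| ≤ n → (a ∈ P ↔ a ∈ Q)) :
    unmatchedCount n P = unmatchedCount n Q := by
  induction n with
  | zero => rfl
  | succ n ih =>
    have h1 := h (n + 1) (by omega) (by push_cast; rw [abs_of_nonneg (by omega)])
    have h2 := h (-(n + 1)) (by omega) (by push_cast; rw [abs_neg, abs_of_nonneg (by omega)])
    have ih' := ih fun a ha hn => h a ha (by push_cast; omega)
    simp only [unmatchedCount, h1, h2, ih']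

lemma unmatchedCount_fillCol (n : ℕ) (P : Finset ℤ) :
    unmatchedCount n (fillCol P (n + 1)) = unmatchedCount n P := by
  refine unmatchedCount_congr fun a _ h => ?_
  rw [abs_le] at h
  rw [mem_fillCol]
  constructor
  · rintro (h | h | h)
    · omega
    · omega
    · exact h
  · tauto

lemma truncate_comp_lower {n : ℕ} {p : Finset ℤ → Prop} [DecidablePred p]
    (hp : ∀ P, ∀ i < n, (p (fillCol P (i + 1)) ↔ p P)) :
    Commute (truncate p) (lower n) := by
  refine Commute.sum_right _ _ _ fun i hi => ?_
  ext x P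
  simp only [Module.End.mul_apply, truncate_apply, colLower_apply, hp P i (Finset.mem_range.1 hi)]
  split_ifs <;> simp

lemma mem_fillCol_of_lt {P : Finset ℤ} {i n : ℕ} (h : i < n) :
    ((n + 1 : ℤ) ∈ fillCol P (i + 1) ↔ (n + 1 : ℤ) ∈ P) ∧
    (-(n + 1 : ℤ) ∈ fillCol P (i + 1) ↔ -(n + 1 : ℤ) ∈ P) := by
  simp only [mem_fillCol]
  constructor <;> exact ⟨fun h' => by rcases h' with h' | h' | h' <;> first | exact h' | omega,
    fun h' => Or.inr (Or.inr h')⟩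

/-- An element of the kernel of `F ^ m` is determined by its coordinates at the sets with fewer
than `m` unmatched columns. -/
theorem eq_zero_of_lower_pow_eq_zero (n m : ℕ) (x : Finset ℤ → Fq) (hx : (lower n ^ m) x = 0)
    (h0 : ∀ P, unmatchedCount n P < m → x P = 0) : x = 0 := by
  induction n generalizing m x with
  | zero =>
    cases m with
    | zero => simpa using hx
    | succ m => ext P; exact h0 P (by simp [unmatchedCount])
  | succ n ih =>
    cases m with
    | zero => simpa using hx
    | succ m =>
      set R := lower n with hR
      set G := colLower n with hG
      have hGR : G * R = qv ^ 2 • (R * G) := colLower_mul_lower n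
      have hGG : G * G = 0 := colLower_mul_self n
      have hc := geom_sum_qv_ne_zero m
      have hexp := add_pow_succ_of_smul_comm hGR hGG m
      set c := ∑ b ∈ Finset.range (m + 1), (qv ^ 2) ^ b with hcdef
      rw [lower_succ, hexp] at hx
      have hx' : (R ^ (m + 1)) x + c • (R ^ m) (G x) = 0 := hx
      have hRG : (R ^ (m + 1)) (G x) = 0 := by
        have h1 := congrArg G hx'
        rw [map_add, map_zero, map_smul, ← Module.End.mul_apply, ← Module.End.mul_apply,
          mul_pow_of_smul_comm hGR, ← Module.End.mul_apply, mul_pow_of_smul_comm hGR,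
          smul_mul_assoc, mul_assoc, hGG] at h1
        simpa [qv_ne_zero] using h1
      have hR2 : (R ^ (m + 2)) x = 0 := by
        have h1 := congrArg R hx'
        rw [map_add, map_zero, map_smul, ← Module.End.mul_apply, ← Module.End.mul_apply,
          ← pow_succ', ← pow_succ', hRG] at h1
        simpa using h1
      let pU : Finset ℤ → Prop := fun P => (n + 1 : ℤ) ∉ P ∧ -(n + 1 : ℤ) ∉ P
      let pN : Finset ℤ → Prop := fun P =>
        ¬ ((n + 1 : ℤ) ∈ P ∧ -(n + 1 : ℤ) ∈ P) ∧ ¬ ((n + 1 : ℤ) ∉ P ∧ -(n + 1 : ℤ) ∉ P)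
      have cU : Commute (truncate pU) R := truncate_comp_lower fun P i hi => by
        simp only [pU, mem_fillCol_of_lt hi]
      have cN : Commute (truncate pN) R := truncate_comp_lower fun P i hi => by
        simp only [pN, mem_fillCol_of_lt hi]
      have tU : truncate pU (G x) = G x := by
        ext P
        simp only [truncate_apply, hG, colLower_apply, pU]
        split_ifs <;> rfl
      have tN : truncate pN (G x) = 0 := by
        ext P
        simp only [truncate_apply, hG, colLower_apply, pN]
        split_ifs with h1 h2
        · exact absurd h2 h1.2
        · rfl
        · rfl
      have xU : truncate pU x = 0 := by
        refine ih (m + 2) _ ?_ fun P hP => ?_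
        · rw [← Module.End.mul_apply, ← (cU.pow_right _).eq, Module.End.mul_apply, hR2, map_zero]
        · rw [truncate_apply]
          split_ifs with h
          · refine h0 P ?_
            rw [unmatchedCount, if_neg (fun h' => h.1 h'.1), if_pos h]
            omega
          · rfl
      have xN : truncate pN x = 0 := by
        refine ih (m + 1) _ ?_ fun P hP => ?_
        · have h1 := congrArg (truncate pN) hx'
          rw [map_add, map_zero, map_smul, ← Module.End.mul_apply, ← Module.End.mul_apply,
            (cN.pow_right _).eq, (cN.pow_right _).eq, Module.End.mul_apply, Module.End.mul_apply,
            tN, map_zero, smul_zero, add_zero] at h1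
          exact h1
        · rw [truncate_apply]
          split_ifs with h
          · refine h0 P ?_
            rw [unmatchedCount, if_neg h.1, if_neg h.2]
            exact hP
          · rfl
      have xG : G x = 0 := by
        refine ih m _ ?_ fun P hP => ?_
        · have h1 := congrArg (truncate pU) hx'
          rw [map_add, map_zero, map_smul, ← Module.End.mul_apply, ← Module.End.mul_apply,
            (cU.pow_right _).eq, (cU.pow_right _).eq, Module.End.mul_apply, Module.End.mul_apply,
            tU, xU, map_zero, zero_add] at h1
          exact (smul_eq_zero.1 h1).resolve_left hc
        · rw [hG, colLower_apply]
          split_ifs with h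
          · rw [h0, mul_zero]
            rw [unmatchedCount, if_pos (by simp [mem_fillCol]), unmatchedCount_fillCol]
            omega
          · rfl
      ext P
      by_cases hD : (n + 1 : ℤ) ∈ P ∧ -(n + 1 : ℤ) ∈ P
      · have h1 := congrFun xG ((P.erase (n + 1)).erase (-(n + 1)))
        have h2 : fillCol ((P.erase (n + 1 : ℤ)).erase (-(n + 1 : ℤ))) (n + 1) = P := by
          ext a
          simp only [mem_fillCol, Finset.mem_erase]
          constructor
          · rintro (rfl | rfl | h)
            exacts [hD.1, hD.2, h.2.2]
          · intro h; tauto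
        rw [hG, colLower_apply, if_pos (by simp), h2] at h1
        exact (mul_eq_zero.1 h1).resolve_left (zpow_ne_zero _ (neg_ne_zero.2 qv_ne_zero))
      · by_cases hU : (n + 1 : ℤ) ∉ P ∧ -(n + 1 : ℤ) ∉ P
        · have h1 := congrFun xU P
          rwa [truncate_apply, if_pos hU] at h1
        · have h1 := congrFun xN P
          rwa [truncate_apply, if_pos ⟨hD, hU⟩] at h1

/-- The column `x` is fully dotted. -/
abbrev Dotted (S : Finset ℤ) (x : ℤ) : Prop := x ∈ S ∧ -x ∈ S

/-- The column `x` is undotted. -/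
abbrev Undotted (S : Finset ℤ) (x : ℤ) : Prop := x ∉ S ∧ -x ∉ S

/-- Properties of the state of the matching algorithm after processing the columns `> j`. -/
structure MatchInv (n : ℕ) (S : Finset ℤ) (j : ℤ) (f : ℤ → ℤ) (U : Finset ℤ) : Prop where
  free : ∀ u ∈ U, j < u ∧ u ≤ n ∧ Undotted S u
  matched : ∀ x, j < x → x ≤ n → Dotted S x → f x ≠ x →
    x < f x ∧ f x ≤ n ∧ Undotted S (f x) ∧ f x ∉ U
  inj : ∀ x z, j < x → x ≤ n → Dotted S x → f x ≠ x → j < z → z ≤ n → Dotted S z → f z ≠ z →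
    f x = f z → x = z
  cover : ∀ u, j < u → u ≤ n → Undotted S u → u ∉ U →
    ∃ z, j < z ∧ z ≤ n ∧ Dotted S z ∧ f z ≠ z ∧ f z = u
  avail : ∀ z, j < z → z ≤ n → Dotted S z → ∀ u ∈ U, z < u → f z ≠ z ∧ f z < u
  nested : ∀ x z : ℤ, j < x → Dotted S x → f x ≠ x → z ≤ n → Dotted S z → x < z → z < f x →
    f z ≠ z ∧ f z < f x
  between : ∀ x u, j < x → x ≤ n → Dotted S x → f x ≠ x → Undotted S u → x < u → u < f x →
    ∃ z, x < z ∧ z ≤ n ∧ Dotted S z ∧ f z ≠ z ∧ f z = u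

lemma MatchInv.match_step {n : ℕ} {S : Finset ℤ} {j : ℤ} {f : ℤ → ℤ} {U : Finset ℤ}
    (h : MatchInv n S j f U) (hj : Dotted S j) (hjn : j ≤ n) {y : ℤ} (hy : y ∈ U)
    (hmin : ∀ u ∈ U, y ≤ u) :
    MatchInv n S (j - 1) (Function.update f j y) (U.erase y) := by
  have hyj := h.free y hy
  have e1 : Function.update f j y j = y := Function.update_self ..
  have e2 : ∀ z, j < z → Function.update f j y z = f z :=
    fun z hz => Function.update_of_ne hz.ne' ..
  generalize Function.update f j y = g at e1 e2
  have split : ∀ z, j - 1 < z → z = j ∨ j < z := fun z hz => by omega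
  refine ⟨?_, ?_, ?_, ?_, ?_, ?_, ?_⟩
  · intro u hu
    have := h.free u (Finset.mem_of_mem_erase hu)
    exact ⟨by omega, this.2⟩
  · intro x hx hn hd hm
    rcases split x hx with rfl | hx
    · rw [e1]; exact ⟨hyj.1, hyj.2.1, hyj.2.2, Finset.notMem_erase _ _⟩
    · rw [e2 x hx] at hm ⊢
      have := h.matched x hx hn hd hm
      exact ⟨this.1, this.2.1, this.2.2.1, fun h' => this.2.2.2 (Finset.mem_of_mem_erase h')⟩
  · intro x z hx hxn hxd hxm hz hzn hzd hzm he
    rcases split x hx with rfl | hx <;> rcases split z hz with rfl | hz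
    · rfl
    · rw [e2 z hz] at hzm he
      rw [e1] at he
      exact absurd (he ▸ hy) (h.matched z hz hzn hzd hzm).2.2.2
    · rw [e2 x hx] at hxm he
      rw [e1] at he
      exact absurd (he ▸ hy) (h.matched x hx hxn hxd hxm).2.2.2
    · rw [e2 x hx] at hxm he
      rw [e2 z hz] at hzm he
      exact h.inj x z hx hxn hxd hxm hz hzn hzd hzm he
  · intro u hu hun hud huU
    rcases split u hu with rfl | hu
    · exact absurd hj.1 hud.1
    · by_cases hyu : u = y
      · exact ⟨j, by omega, hjn, hj, by rw [e1]; omega, by rw [e1, hyu]⟩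
      · obtain ⟨z, hz, hz'⟩ := h.cover u hu hun hud fun h' => huU (Finset.mem_erase.2 ⟨hyu, h'⟩)
        exact ⟨z, by omega, by rwa [e2 z hz]⟩
  · intro z hz hzn hzd u hu hzu
    rw [Finset.mem_erase] at hu
    rcases split z hz with rfl | hz
    · rw [e1]
      have := hmin u hu.2
      exact ⟨by omega, by omega⟩
    · rw [e2 z hz]; exact h.avail z hz hzn hzd u hu.2 hzu
  · intro x z hx hxd hxm hzn hzd hxz hz
    rcases split x hx with rfl | hx
    · rw [e1] at hz ⊢
      rw [e2 z hxz]
      exact h.avail z hxz hzn hzd y hy hz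
    · rw [e2 x hx] at hxm hz ⊢
      rw [e2 z (by omega)]
      exact h.nested x z hx hxd hxm hzn hzd hxz hz
  · intro x u hx hxn hxd hxm hud hxu hu
    rcases split x hx with rfl | hx
    · rw [e1] at hu
      obtain ⟨z, hz, hz'⟩ := h.cover u hxu (by omega) hud fun h' => by have := hmin u h'; omega
      exact ⟨z, hz, by rwa [e2 z hz]⟩
    · rw [e2 x hx] at hxm hu
      obtain ⟨z, hz, hz'⟩ := h.between x u hx hxn hxd hxm hud hxu hu
      exact ⟨z, hz, by rwa [e2 z (by omega)]⟩

lemma MatchInv.skip_step {n : ℕ} {S : Finset ℤ} {j : ℤ} {f : ℤ → ℤ} {U V : Finset ℤ}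
    (h : MatchInv n S j f U) (hj : f j = j) (hjn : j ≤ n)
    (hd : Dotted S j → V = ∅) (hUV : U ⊆ V) (hV : ∀ u ∈ V, u = j ∨ u ∈ U)
    (hu : Undotted S j ↔ j ∈ V) :
    MatchInv n S (j - 1) f V := by
  have split : ∀ z, j - 1 < z → z = j ∨ j < z := fun z hz => by omega
  have hU0 : Dotted S j → U = ∅ := fun h' => Finset.subset_empty.1 (hd h' ▸ hUV)
  refine ⟨?_, ?_, ?_, ?_, ?_, ?_, ?_⟩
  · intro u huV
    rcases hV u huV with rfl | hu'
    · exact ⟨by omega, hjn, hu.2 huV⟩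
    · have := h.free u hu'
      exact ⟨by omega, this.2⟩
  · intro x hx hn hxd hm
    rcases split x hx with rfl | hx
    · exact absurd hj hm
    · have := h.matched x hx hn hxd hm
      refine ⟨this.1, this.2.1, this.2.2.1, fun h' => ?_⟩
      rcases hV _ h' with h1 | h1
      · omega
      · exact this.2.2.2 h1
  · intro x z hx hxn hxd hxm hz hzn hzd hzm he
    rcases split x hx with rfl | hx
    · exact absurd hj hxm
    rcases split z hz with rfl | hz
    · exact absurd hj hzm
    exact h.inj x z hx hxn hxd hxm hz hzn hzd hzm he
  · intro u hu' hun hud huV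
    rcases split u hu' with rfl | hu'
    · exact absurd (hu.1 hud) huV
    · obtain ⟨z, hz, hz'⟩ := h.cover u hu' hun hud fun h' => huV (hUV h')
      exact ⟨z, by omega, hz'⟩
  · intro z hz hzn hzd u huV hzu
    rcases split z hz with rfl | hz
    · simp [hd hzd] at huV
    · rcases hV u huV with rfl | hu'
      · omega
      · exact h.avail z hz hzn hzd u hu' hzu
  · intro x z hx hxd hxm hzn hzd hxz hz
    rcases split x hx with rfl | hx
    · exact absurd hj hxm
    · exact h.nested x z hx hxd hxm hzn hzd hxz hz
  · intro x u hx hxn hxd hxm hud hxu hu'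
    rcases split x hx with rfl | hx
    · exact absurd hj hxm
    · exact h.between x u hx hxn hxd hxm hud hxu hu'

/-- The matching algorithm after `t` steps. -/
def matchSteps (n : ℕ) (S : Finset ℤ) (t : ℕ) : (ℤ → ℤ) × Finset ℤ :=
  ((List.range t).map (fun t : ℕ => (n : ℤ) - t)).foldl (fun p x => stepCol S x p) (id, ∅)

lemma matchSteps_succ (n : ℕ) (S : Finset ℤ) (t : ℕ) :
    matchSteps n S (t + 1) = stepCol S (n - t) (matchSteps n S t) := by
  simp [matchSteps, List.range_succ]

lemma matchCol_eq (n : ℕ) (S : Finset ℤ) (x : ℤ) : matchCol n S x = (matchSteps n S n).1 x := by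
  simp only [matchCol, matchData, matchSteps, bind_pure_comp, List.map_eq_map, List.map_map]
  rfl

lemma stepCol_fst_of_ne {S : Finset ℤ} {x z : ℤ} (p : (ℤ → ℤ) × Finset ℤ) (h : z ≠ x) :
    (stepCol S x p).1 z = p.1 z := by
  unfold stepCol
  split_ifs <;> simp [h]

lemma matchSteps_fst_of_le (n : ℕ) (S : Finset ℤ) (t : ℕ) {z : ℤ} (hz : z ≤ n - t) :
    (matchSteps n S t).1 z = z := by
  induction t with
  | zero => rfl
  | succ t ih =>
    rw [matchSteps_succ, stepCol_fst_of_ne _ (by push_cast at hz; omega),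
      ih (by push_cast at hz; omega)]

lemma stepCol_of_dotted {S : Finset ℤ} {x : ℤ} {p : (ℤ → ℤ) × Finset ℤ} (h : Dotted S x)
    (hU : p.2.Nonempty) : stepCol S x p =
      (Function.update p.1 x (p.2.min' hU), p.2.erase (p.2.min' hU)) := by
  rw [stepCol, if_pos h, dif_pos hU]

lemma stepCol_of_dotted_of_empty {S : Finset ℤ} {x : ℤ} {p : (ℤ → ℤ) × Finset ℤ}
    (h : Dotted S x) (hU : ¬ p.2.Nonempty) : stepCol S x p = (Function.update p.1 x x, p.2) := by
  rw [stepCol, if_pos h, dif_neg hU]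

lemma stepCol_of_undotted {S : Finset ℤ} {x : ℤ} {p : (ℤ → ℤ) × Finset ℤ} (h : Undotted S x) :
    stepCol S x p = (p.1, insert x p.2) := by
  rw [stepCol, if_neg (fun h' => h.1 h'.1), if_pos h]

lemma stepCol_of_neither {S : Finset ℤ} {x : ℤ} {p : (ℤ → ℤ) × Finset ℤ} (h : ¬ Dotted S x)
    (h' : ¬ Undotted S x) : stepCol S x p = p := by
  rw [stepCol, if_neg h, if_neg h']

lemma matchInv_matchSteps (n : ℕ) (S : Finset ℤ) (t : ℕ) :
    MatchInv n S (n - t) (matchSteps n S t).1 (matchSteps n S t).2 := by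
  induction t with
  | zero =>
    refine ⟨?_, ?_, ?_, ?_, ?_, ?_, ?_⟩
    · intro u hu; simp [matchSteps] at hu
    all_goals
      intros
      omega
  | succ t ih =>
    have hid := matchSteps_fst_of_le n S t le_rfl
    rw [matchSteps_succ]
    have hj : (n : ℤ) - (t + 1 : ℕ) = (n - t) - 1 := by push_cast; ring
    rw [hj]
    generalize matchSteps n S t = p at ih hid
    have hjn : (n : ℤ) - t ≤ n := by omega
    generalize (n : ℤ) - t = j at ih hid hjn
    have hjU : j ∉ p.2 := fun h => lt_irrefl _ (ih.free j h).1
    by_cases hd : Dotted S j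
    · by_cases hU : p.2.Nonempty
      · rw [stepCol_of_dotted hd hU]
        exact ih.match_step hd hjn (Finset.min'_mem _ _) fun u hu => Finset.min'_le _ _ hu
      · have hU' := Finset.not_nonempty_iff_eq_empty.1 hU
        rw [stepCol_of_dotted_of_empty hd hU]
        have hup : Function.update p.1 j j = p.1 := by
          conv_lhs => rw [← hid]
          simp [hid]
        simp only [hup]
        exact ih.skip_step hid hjn (fun _ => hU') subset_rfl (fun u hu => Or.inr hu)
          ⟨fun h => absurd hd.1 h.1, fun h => absurd h hjU⟩
    · by_cases hu : Undotted S j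
      · rw [stepCol_of_undotted hu]
        exact ih.skip_step hid hjn (fun h => absurd h hd) (Finset.subset_insert _ _)
          (fun u hu => Finset.mem_insert.1 hu) ⟨fun _ => Finset.mem_insert_self _ _, fun _ => hu⟩
      · rw [stepCol_of_neither hd hu]
        exact ih.skip_step hid hjn (fun h => absurd h hd) subset_rfl (fun u hu => Or.inr hu)
          ⟨fun h => absurd h hu, fun h => absurd h hjU⟩

lemma matchInv_matchCol (n : ℕ) (S : Finset ℤ) :
    ∃ U, MatchInv n S 0 (matchCol n S) U :=
  ⟨_, by simpa [← matchCol_eq, ← funext (matchCol_eq n S)] using matchInv_matchSteps n S n⟩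

/-- The condition that all fully dotted columns get matched, split at an intermediate state of
the matching algorithm. -/
lemma unmatchedCount_eq_zero_iff_matchSteps (n : ℕ) (S : Finset ℤ) (t : ℕ) (ht : t ≤ n) :
    unmatchedCount n S = 0 ↔
      (∀ x : ℤ, n - t < x → x ≤ n → Dotted S x → (matchSteps n S t).1 x ≠ x) ∧
      unmatchedCount (n - t) S ≤ (matchSteps n S t).2.card := by
  induction t with
  | zero =>
    simp only [Nat.sub_zero, matchSteps]
    constructor
    · intro h
      exact ⟨fun x h1 h2 => by simp at h1; omega, by simp [h]⟩
    · intro h; simpa using h.2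
  | succ t ih =>
    rw [ih (by omega)]
    have inv := matchInv_matchSteps n S t
    obtain ⟨r, hr⟩ : ∃ r, n = r + 1 + t := ⟨n - t - 1, by omega⟩
    have e1 : n - t = r + 1 := by omega
    have e2 : n - (t + 1) = r := by omega
    have e3 : (n : ℤ) - t = r + 1 := by omega
    have e4 : (n : ℤ) - (t + 1 : ℕ) = r := by push_cast; omega
    rw [matchSteps_succ, e1, e2, e3, e4]
    rw [e3] at inv
    generalize matchSteps n S t = p at inv
    have hn : ((r : ℤ) + 1) ≤ n := by omega
    have key : (∀ x : ℤ, (r : ℤ) < x → x ≤ n → Dotted S x → (stepCol S (r + 1) p).1 x ≠ x) ↔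
        ((∀ x : ℤ, (r + 1 : ℤ) < x → x ≤ n → Dotted S x → p.1 x ≠ x) ∧
          (Dotted S (r + 1) → (stepCol S (r + 1) p).1 (r + 1) ≠ r + 1)) := by
      constructor
      · intro h
        refine ⟨fun x hx hxn hd => ?_, fun hd => h _ (by omega) hn hd⟩
        rw [← stepCol_fst_of_ne (S := S) p (ne_of_gt hx)]
        exact h x (by omega) hxn hd
      · rintro ⟨h1, h2⟩ x hx hxn hd
        rcases eq_or_ne x (r + 1) with rfl | hne
        · exact h2 hd
        · rw [stepCol_fst_of_ne p hne]
          exact h1 x (by omega) hxn hd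
    rw [key, and_assoc]
    refine and_congr_right fun _ => ?_
    rw [unmatchedCount]
    by_cases hd : Dotted S (r + 1)
    · rw [if_pos hd]
      by_cases hU : p.2.Nonempty
      · rw [stepCol_of_dotted hd hU]
        have hm := Finset.min'_mem _ hU
        have := (inv.free _ hm).1
        have hc := Finset.card_pos.2 hU
        simp only [Function.update_self, Finset.card_erase_of_mem hm]
        constructor
        · intro h
          exact ⟨fun _ => by omega, by omega⟩
        · rintro ⟨-, h⟩; omega
      · rw [stepCol_of_dotted_of_empty hd hU]
        have hU' := Finset.not_nonempty_iff_eq_empty.1 hU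
        simp only [hU', Finset.card_empty, Function.update_self]
        exact ⟨fun h => by omega, fun h => absurd rfl (h.1 hd)⟩
    · rw [if_neg hd]
      by_cases hu : Undotted S (r + 1)
      · rw [if_pos hu, stepCol_of_undotted hu]
        have hj : (r + 1 : ℤ) ∉ p.2 := fun h => lt_irrefl _ (inv.free _ h).1
        simp only [Finset.card_insert_of_notMem hj, hd, false_imp_iff, true_and]
        omega
      · rw [if_neg hu, stepCol_of_neither hd hu]
        simp only [hd, false_imp_iff, true_and]

lemma unmatchedCount_eq_zero_iff (n : ℕ) (S : Finset ℤ) :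
    unmatchedCount n S = 0 ↔
      ∀ x ∈ Finset.Icc (1 : ℤ) n, x ∈ S → -x ∈ S → matchCol n S x ≠ x := by
  rw [unmatchedCount_eq_zero_iff_matchSteps n S n le_rfl]
  simp only [sub_self, Nat.sub_self, unmatchedCount, Nat.zero_le, and_true, Finset.mem_Icc,
    matchCol_eq]
  exact ⟨fun h x hx h1 h2 => h x (by omega) hx.2 ⟨h1, h2⟩,
    fun h x h0 hn hd => h x ⟨by omega, hn⟩ hd.1 hd.2⟩

lemma mem_goodSets {n k : ℕ} {S : Finset ℤ} :
    S ∈ goodSets n k ↔ S ⊆ Iset n ∧ S.card = k ∧ unmatchedCount n S = 0 := by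
  rw [goodSets, Finset.mem_filter, Finset.mem_powerset, unmatchedCount_eq_zero_iff]

/-- A complete matching of the fully dotted columns `L` of `S` with undotted columns to their
right, such that the intervals spanned by the pairs contain no unmatched columns and are nested. -/
structure IsMatching (n : ℕ) (S : Finset ℤ) (σ : ℤ → ℤ) (L : Finset ℤ) : Prop where
  mem_iff : ∀ x, x ∈ L ↔ 0 < x ∧ x ≤ n ∧ Dotted S x
  lt : ∀ x ∈ L, x < σ x
  le : ∀ x ∈ L, σ x ≤ n
  undotted : ∀ x ∈ L, Undotted S (σ x)
  inj : Set.InjOn σ L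
  nested : ∀ x ∈ L, ∀ z ∈ L, x < z → z < σ x → σ z < σ x
  between : ∀ x ∈ L, ∀ u, Undotted S u → x < u → u < σ x → ∃ z ∈ L, x < z ∧ σ z = u

lemma isMatching_matchCol {n : ℕ} {S : Finset ℤ} (h : unmatchedCount n S = 0) :
    IsMatching n S (matchCol n S) (LSet n S) := by
  rw [unmatchedCount_eq_zero_iff] at h
  obtain ⟨U, inv⟩ := matchInv_matchCol n S
  have mem : ∀ x, x ∈ LSet n S ↔ 0 < x ∧ x ≤ n ∧ Dotted S x := by
    intro x
    rw [LSet, Finset.mem_filter, Finset.mem_Icc]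
    constructor
    · rintro ⟨⟨h1, h2⟩, h3, h4, -⟩
      exact ⟨by omega, h2, h3, h4⟩
    · rintro ⟨h1, h2, h3⟩
      have h0 : 1 ≤ x := by omega
      exact ⟨⟨h0, h2⟩, h3.1, h3.2, h x (Finset.mem_Icc.2 ⟨h0, h2⟩) h3.1 h3.2⟩
  have ne : ∀ x ∈ LSet n S, matchCol n S x ≠ x := fun x hx => (Finset.mem_filter.1 hx).2.2.2
  have main : ∀ x ∈ LSet n S, _ := fun x hx =>
    inv.matched x ((mem x).1 hx).1 ((mem x).1 hx).2.1 ((mem x).1 hx).2.2 (ne x hx)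
  refine ⟨mem, fun x hx => (main x hx).1, fun x hx => (main x hx).2.1,
    fun x hx => (main x hx).2.2.1, ?_, ?_, ?_⟩
  · intro x hx z hz he
    have hx' := (mem x).1 hx
    have hz' := (mem z).1 hz
    exact inv.inj x z hx'.1 hx'.2.1 hx'.2.2 (ne x hx) hz'.1 hz'.2.1 hz'.2.2 (ne z hz) he
  · intro x hx z hz h1 h2
    have hx' := (mem x).1 hx
    have hz' := (mem z).1 hz
    exact (inv.nested x z hx'.1 hx'.2.2 (ne x hx) hz'.2.1 hz'.2.2 h1 h2).2
  · intro x hx u hu h1 h2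
    have hx' := (mem x).1 hx
    obtain ⟨z, hz, hzn, hzd, -, hzu⟩ :=
      inv.between x u hx'.1 hx'.2.1 hx'.2.2 (ne x hx) hu h1 h2
    exact ⟨z, (mem z).2 ⟨by omega, hzn, hzd⟩, hz, hzu⟩

/-- Move the dots from the columns in `X` to their images under `σ`. -/
def swapCols (σ : ℤ → ℤ) (S X : Finset ℤ) : Finset ℤ := (S \ pmSet X) ∪ pmSet (X.image σ)

lemma mem_negSet {X : Finset ℤ} {a : ℤ} : a ∈ negSet X ↔ -a ∈ X := by
  rw [negSet, Finset.mem_image]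
  exact ⟨by rintro ⟨b, hb, rfl⟩; simpa using hb, fun h => ⟨-a, h, neg_neg a⟩⟩

lemma mem_pmSet {X : Finset ℤ} {a : ℤ} : a ∈ pmSet X ↔ a ∈ X ∨ -a ∈ X := by
  rw [pmSet, Finset.mem_union, mem_negSet]

lemma mem_Iset {n : ℕ} {a : ℤ} : a ∈ Iset n ↔ a ≠ 0 ∧ -(n : ℤ) ≤ a ∧ a ≤ n := by
  rw [Iset, Finset.mem_erase, Finset.mem_Icc]

lemma neg_mem_Iset {n : ℕ} {a : ℤ} : -a ∈ Iset n ↔ a ∈ Iset n := by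
  rw [mem_Iset, mem_Iset]; omega

lemma sum_pmSet {M : Type*} [AddCommMonoid M] {X : Finset ℤ} (hX : ∀ x ∈ X, 0 < x) (g : ℤ → M) :
    ∑ a ∈ pmSet X, g a = ∑ x ∈ X, (g x + g (-x)) := by
  have hd : Disjoint X (negSet X) := by
    rw [Finset.disjoint_left]
    intro a ha hb
    have := hX _ ha
    have := hX _ (mem_negSet.1 hb)
    omega
  rw [pmSet, Finset.sum_union hd, Finset.sum_add_distrib, negSet,
    Finset.sum_image fun a _ b _ h => neg_injective h]

namespace IsMatching

variable {n : ℕ} {S : Finset ℤ} {σ : ℤ → ℤ} {L X : Finset ℤ}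

lemma pos (h : IsMatching n S σ L) {x : ℤ} (hx : x ∈ L) : 0 < x := ((h.mem_iff x).1 hx).1

lemma dotted (h : IsMatching n S σ L) {x : ℤ} (hx : x ∈ L) : Dotted S x :=
  ((h.mem_iff x).1 hx).2.2

lemma image_pos (h : IsMatching n S σ L) (hX : X ⊆ L) : ∀ y ∈ X.image σ, 0 < y := by
  intro y hy
  obtain ⟨x, hx, rfl⟩ := Finset.mem_image.1 hy
  exact (h.pos (hX hx)).trans (h.lt x (hX hx))

lemma mem_swapCols (h : IsMatching n S σ L) (hX : X ⊆ L) {i : ℤ} (hi : 0 < i) :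
    (i ∈ swapCols σ S X ↔ (i ∈ S ∧ i ∉ X) ∨ i ∈ X.image σ) ∧
    (-i ∈ swapCols σ S X ↔ (-i ∈ S ∧ i ∉ X) ∨ i ∈ X.image σ) := by
  have h1 : -i ∉ X := fun h' => by have := h.pos (hX h'); omega
  have h2 : -i ∉ X.image σ := fun h' => by have := h.image_pos hX _ h'; omega
  simp only [swapCols, Finset.mem_union, Finset.mem_sdiff, mem_pmSet, h1, h2, neg_neg, or_false,
    false_or, and_self]

lemma notMem_image_of_mem (h : IsMatching n S σ L) (hX : X ⊆ L) {i : ℤ} (hi : i ∈ L) :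
    i ∉ X.image σ := by
  intro h'
  obtain ⟨x, hx, rfl⟩ := Finset.mem_image.1 h'
  exact (h.undotted x (hX hx)).1 (h.dotted hi).1

lemma image_notMem (h : IsMatching n S σ L) {x : ℤ} (hx : x ∈ L) : σ x ∉ L :=
  fun h' => (h.undotted x hx).1 (h.dotted h').1

lemma image_mem_image_iff (h : IsMatching n S σ L) (hX : X ⊆ L) {x : ℤ} (hx : x ∈ L) :
    σ x ∈ X.image σ ↔ x ∈ X := by
  rw [Finset.mem_image]
  exact ⟨fun ⟨z, hz, he⟩ => h.inj (hX hz) hx he ▸ hz, fun h' => ⟨x, h', rfl⟩⟩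

lemma colSign_of_mem (h : IsMatching n S σ L) (hX : X ⊆ L) {x : ℤ} (hx : x ∈ L) :
    colSign (swapCols σ S X) x = if x ∈ X then 1 else -1 := by
  have hm := h.mem_swapCols hX (h.pos hx)
  have h1 := h.notMem_image_of_mem hX hx
  have h2 := h.dotted hx
  simp only [colSign, hm.1, hm.2, h1, h2.1, h2.2]
  by_cases hxX : x ∈ X <;> simp [hxX]

lemma colSign_image (h : IsMatching n S σ L) (hX : X ⊆ L) {x : ℤ} (hx : x ∈ L) :
    colSign (swapCols σ S X) (σ x) = if x ∈ X then -1 else 1 := by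
  have hm := h.mem_swapCols hX ((h.pos hx).trans (h.lt x hx))
  have h1 := h.image_mem_image_iff hX hx
  have h2 := h.undotted x hx
  simp only [colSign, hm.1, hm.2, h1, h2.1, h2.2]
  by_cases hxX : x ∈ X <;> simp [hxX]

lemma sum_colSign_Ioo (h : IsMatching n S σ L) (hX : X ⊆ L) {x : ℤ} (hx : x ∈ L) :
    ∑ j ∈ Finset.Ioo x (σ x), colSign (swapCols σ S X) j = 0 := by
  set A := L.filter fun z => x < z ∧ z < σ x with hA
  have hAL : A ⊆ L := Finset.filter_subset _ _
  have hsub : A ∪ A.image σ ⊆ Finset.Ioo x (σ x) := by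
    intro j hj
    rw [Finset.mem_Ioo]
    rcases Finset.mem_union.1 hj with hj | hj
    · exact (Finset.mem_filter.1 hj).2
    · obtain ⟨z, hz, rfl⟩ := Finset.mem_image.1 hj
      obtain ⟨hz, h1, h2⟩ := Finset.mem_filter.1 hz
      exact ⟨h1.trans (h.lt z hz), h.nested x hx z hz h1 h2⟩
  have hdisj : Disjoint A (A.image σ) := by
    rw [Finset.disjoint_left]
    intro j hj
    exact h.notMem_image_of_mem hAL (hAL hj)
  rw [← Finset.sum_subset hsub, Finset.sum_union hdisj,
    Finset.sum_image fun a ha b hb => h.inj (hAL ha) (hAL hb), ← Finset.sum_add_distrib]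
  · refine Finset.sum_eq_zero fun z hz => ?_
    rw [h.colSign_of_mem hX (hAL hz), h.colSign_image hX (hAL hz)]
    split_ifs <;> simp
  · intro j hj hjA
    rw [Finset.mem_Ioo] at hj
    rw [Finset.mem_union, not_or] at hjA
    have hj0 : 0 < j := (h.pos hx).trans hj.1
    have hjn : j ≤ n := hj.2.le.trans (h.le x hx)
    have hd : ¬ Dotted S j := fun hd =>
      hjA.1 (Finset.mem_filter.2 ⟨(h.mem_iff j).2 ⟨hj0, hjn, hd⟩, hj⟩)
    have hu : ¬ Undotted S j := fun hu => by
      obtain ⟨z, hz, hxz, rfl⟩ := h.between x hx j hu hj.1 hj.2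
      exact hjA.2 (Finset.mem_image_of_mem σ
        (Finset.mem_filter.2 ⟨hz, hxz, (h.lt z hz).trans hj.2⟩))
    have h1 : j ∉ X := fun h' => hd (h.dotted (hX h'))
    have h2 : j ∉ X.image σ := fun h' => by
      obtain ⟨z, hz, rfl⟩ := Finset.mem_image.1 h'
      exact hu (h.undotted z (hX hz))
    have hm := h.mem_swapCols hX hj0
    simp only [colSign, hm.1, hm.2, h1, h2, not_false_eq_true, and_true, or_false]
    rw [if_neg hd, if_neg hu]

lemma sum_swapCols {M : Type*} [AddCommMonoid M] (h : IsMatching n S σ L) (hX : X ⊆ L)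
    (g : ℤ → M) :
    ∑ a ∈ swapCols σ S X, g a + ∑ x ∈ X, (g x + g (-x)) =
      ∑ a ∈ S, g a + ∑ x ∈ X, (g (σ x) + g (-σ x)) := by
  have hX0 : ∀ x ∈ X, 0 < x := fun x hx => h.pos (hX hx)
  have hsub : pmSet X ⊆ S := by
    intro a ha
    rcases mem_pmSet.1 ha with ha | ha
    · exact (h.dotted (hX ha)).1
    · simpa using (h.dotted (hX ha)).2
  have hdisj : Disjoint (S \ pmSet X) (pmSet (X.image σ)) := by
    rw [Finset.disjoint_left]
    intro a ha ha'
    have haS := (Finset.mem_sdiff.1 ha).1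
    rcases mem_pmSet.1 ha' with h' | h' <;> obtain ⟨x, hx, he⟩ := Finset.mem_image.1 h'
    · exact (h.undotted x (hX hx)).1 (he ▸ haS)
    · exact (h.undotted x (hX hx)).2 (by rw [he, neg_neg]; exact haS)
  rw [swapCols, Finset.sum_union hdisj, sum_pmSet (h.image_pos hX), ← sum_pmSet hX0,
    Finset.sum_image fun a ha b hb => h.inj (hX ha) (hX hb), add_right_comm,
    Finset.sum_sdiff hsub]

lemma card_swapCols (h : IsMatching n S σ L) (hX : X ⊆ L) : (swapCols σ S X).card = S.card := by
  have := h.sum_swapCols hX fun _ => 1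
  simpa using this

lemma swapCols_subset (h : IsMatching n S σ L) (hS : S ⊆ Iset n) (hX : X ⊆ L) :
    swapCols σ S X ⊆ Iset n := by
  intro a ha
  rcases Finset.mem_union.1 ha with ha | ha
  · exact hS (Finset.mem_sdiff.1 ha).1
  · rw [mem_Iset]
    rcases mem_pmSet.1 ha with ha | ha <;>
    · have := h.image_pos hX _ ha
      obtain ⟨x, hx, he⟩ := Finset.mem_image.1 ha
      have := h.le x (hX hx)
      omega

lemma sum_natAbs_lt (h : IsMatching n S σ L) (hX : X ⊆ L) (hne : X.Nonempty) :
    ∑ a ∈ S, a.natAbs < ∑ a ∈ swapCols σ S X, a.natAbs := by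
  have := h.sum_swapCols hX Int.natAbs
  have : ∑ x ∈ X, (x.natAbs + (-x).natAbs) < ∑ x ∈ X, ((σ x).natAbs + (-σ x).natAbs) := by
    refine Finset.sum_lt_sum_of_nonempty hne fun x hx => ?_
    have := h.pos (hX hx)
    have := h.lt x (hX hx)
    omega
  omega

end IsMatching

lemma card_filter_natAbs_lt {Z : Finset ℤ} {i : ℤ} (hZ : ∀ x, x ∈ Z ↔ -x ∈ Z) :
    (Z.filter fun x => x ≠ 0 ∧ |x| < i).card = 2 * ((Finset.Ioo 0 i).filter (· ∈ Z)).card := by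
  have e : (Z.filter fun x => x ≠ 0 ∧ |x| < i) = pmSet ((Finset.Ioo 0 i).filter (· ∈ Z)) := by
    ext a
    rw [mem_pmSet, Finset.mem_filter, Finset.mem_filter, Finset.mem_filter, Finset.mem_Ioo,
      Finset.mem_Ioo, ← hZ a, abs_lt]
    constructor
    · rintro ⟨h1, h2, h3⟩
      rcases lt_or_gt_of_ne h2 with h4 | h4
      · exact Or.inr ⟨⟨by omega, by omega⟩, h1⟩
      · exact Or.inl ⟨⟨by omega, by omega⟩, h1⟩
    · rintro (⟨h1, h2⟩ | ⟨h1, h2⟩) <;> exact ⟨h2, by omega, by omega⟩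
  rw [e, Finset.card_eq_sum_ones, sum_pmSet fun x hx =>
    (Finset.mem_Ioo.1 (Finset.mem_filter.1 hx).1).1]
  simp [mul_comm]

lemma mem_Szero {S : Finset ℤ} {x : ℤ} : x ∈ Szero S ↔ x ∈ S ∧ -x ∈ S := by
  rw [Szero, Finset.mem_inter, mem_negSet]

lemma mem_Szeroc {n : ℕ} {S : Finset ℤ} {x : ℤ} :
    x ∈ Szeroc n S ↔ x ∈ Iset n ∧ x ∉ S ∧ -x ∉ S := by
  rw [Szeroc, Finset.mem_inter, mem_negSet, Finset.mem_sdiff, Finset.mem_sdiff]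
  rw [neg_mem_Iset]; tauto

lemma wLt_eq {n : ℕ} {i : ℤ} {S : Finset ℤ} (hi : i ≤ n) :
    wLt n i S = ∑ j ∈ Finset.Ioo 0 i, colSign S j := by
  have h1 := card_filter_natAbs_lt (Z := Szero S) (i := i) fun x => by
    rw [mem_Szero, mem_Szero, neg_neg, and_comm]
  have h2 := card_filter_natAbs_lt (Z := Szeroc n S) (i := i) fun x => by
    rw [mem_Szeroc, mem_Szeroc, neg_neg, neg_mem_Iset, and_comm (a := x ∉ S)]
  have h3 : ∑ j ∈ Finset.Ioo 0 i, colSign S j =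
      (((Finset.Ioo 0 i).filter (· ∈ Szeroc n S)).card : ℤ) -
        ((Finset.Ioo 0 i).filter (· ∈ Szero S)).card := by
    rw [Finset.card_filter, Finset.card_filter]
    push_cast
    rw [← Finset.sum_sub_distrib]
    refine Finset.sum_congr rfl fun j hj => ?_
    rw [Finset.mem_Ioo] at hj
    have hjI : j ∈ Iset n := by rw [mem_Iset]; omega
    simp only [colSign, mem_Szero, mem_Szeroc, hjI, true_and]
    by_cases ha : j ∈ S <;> by_cases hb : -j ∈ S <;> simp [ha, hb]
  rw [wLt, h1, h2, h3]
  push_cast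
  omega

lemma sum_Ioo_eq_colWeight (P : Finset ℤ) (i : ℕ) :
    ∑ j ∈ Finset.Ioo (0 : ℤ) (i + 1), colSign P j = colWeight P i := by
  symm
  refine Finset.sum_nbij' (fun j : ℕ => (j + 1 : ℤ)) (fun j => (j - 1).toNat) ?_ ?_ ?_ ?_ ?_ <;>
    intro j hj <;> simp only [Finset.mem_range, Finset.mem_Ioo] at hj ⊢ <;> omega

lemma vS_of_subset {n : ℕ} {T : Finset ℤ} (h : T ⊆ Iset n) :
    vS n T = Finsupp.single (⟨T, h⟩ : Bset n) (1 : Fq) := dif_pos h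

lemma Fop_vS {n : ℕ} {T : Finset ℤ} (h : T ⊆ Iset n) : Fop n (vS n T) = FAct n T := by
  rw [vS_of_subset h, Fop, mkOp, Finsupp.linearCombination_single, one_smul]

lemma bvecL_eq (n : ℕ) (S : Finset ℤ) : bvecL n S =
    ∑ X ∈ (LSet n S).powerset, (qv ^ (-(X.card : ℤ))) • vS n (swapCols (matchCol n S) S X) := rfl

/-- The summand of `F v_S` that removes the column `i`. -/
def removeTerm (n : ℕ) (S : Finset ℤ) (i : ℤ) : Lam n :=
  ((-qv) ^ wLt n i S) • vS n ((S.erase i).erase (-i))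

namespace IsMatching

variable {n : ℕ} {S : Finset ℤ} {σ : ℤ → ℤ} {L X : Finset ℤ}

lemma FAct_swapCols (h : IsMatching n S σ L) (hX : X ⊆ L) :
    FAct n (swapCols σ S X) =
      ∑ x ∈ L, removeTerm n (swapCols σ S X) (if x ∈ X then σ x else x) := by
  symm
  refine Finset.sum_bij (fun x _ => if x ∈ X then σ x else x) ?_ ?_ ?_ fun _ _ => rfl
  · intro x hx
    have h0 := h.pos hx
    have hl := h.lt x hx
    have hle := h.le x hx
    have hxn := ((h.mem_iff x).1 hx).2.1
    have hd := h.dotted hx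
    simp only [Finset.mem_filter, Finset.mem_Icc, mem_Szero, neg_neg]
    by_cases hxX : x ∈ X
    · have hm := h.mem_swapCols hX (h0.trans hl)
      have := Finset.mem_image_of_mem σ hxX
      simp only [if_pos hxX, hm.1, hm.2, this, or_true, and_self, and_true]
      omega
    · have hm := h.mem_swapCols hX h0
      simp only [hxX, if_false, hm.1, hm.2, hd.1, hd.2, not_false_eq_true, true_or, and_self,
        and_true]
      omega
  · intro x hx z hz he
    split_ifs at he
    · exact h.inj hx hz he
    · exact absurd (he ▸ hz) (h.image_notMem hx)
    · exact absurd (he ▸ hx) (h.image_notMem hz)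
    · exact he
  · intro i hi
    rw [Finset.mem_filter, Finset.mem_Icc, mem_Szero] at hi
    obtain ⟨⟨h1, h2⟩, ⟨h3, h4⟩, -⟩ := hi
    have hi0 : 0 < i := by omega
    have hm := h.mem_swapCols hX hi0
    rw [hm.1] at h3
    rw [hm.2] at h4
    by_cases hi' : i ∈ X.image σ
    · obtain ⟨x, hx, rfl⟩ := Finset.mem_image.1 hi'
      exact ⟨x, hX hx, if_pos hx⟩
    · have h3 := h3.resolve_right hi'
      have h4 := h4.resolve_right hi'
      exact ⟨i, (h.mem_iff i).2 ⟨hi0, h2, h3.1, h4.1⟩, if_neg h3.2⟩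

lemma wLt_swapCols_insert (h : IsMatching n S σ L) (hX : X ⊆ L) {x : ℤ} (hx : x ∈ L) :
    wLt n (σ x) (swapCols σ S (insert x X)) = wLt n x (swapCols σ S X) + 1 := by
  have h0 := h.pos hx
  have hl := h.lt x hx
  have hX' : insert x X ⊆ L := Finset.insert_subset hx hX
  rw [wLt_eq (h.le x hx), wLt_eq ((h.mem_iff x).1 hx).2.1]
  have e : Finset.Ioo 0 (σ x) = insert x (Finset.Ioo 0 x ∪ Finset.Ioo x (σ x)) := by
    ext a; simp only [Finset.mem_insert, Finset.mem_union, Finset.mem_Ioo]; omega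
  have hd : Disjoint (Finset.Ioo 0 x) (Finset.Ioo x (σ x)) := by
    rw [Finset.disjoint_left]; intro a; simp only [Finset.mem_Ioo]; omega
  rw [e, Finset.sum_insert (by simp), Finset.sum_union hd, h.sum_colSign_Ioo hX' hx,
    h.colSign_of_mem hX' hx, if_pos (Finset.mem_insert_self _ _), add_zero, add_comm]
  congr 1
  refine Finset.sum_congr rfl fun j hj => ?_
  rw [Finset.mem_Ioo] at hj
  have hm := h.mem_swapCols hX hj.1
  have hm' := h.mem_swapCols hX' hj.1
  have h1 : j ≠ x := hj.2.ne
  have h2 : j ≠ σ x := by omega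
  simp only [colSign, hm.1, hm.2, hm'.1, hm'.2, Finset.image_insert, Finset.mem_insert, h1, h2,
    false_or]

lemma erase_swapCols_insert (h : IsMatching n S σ L) (hX : X ⊆ L) {x : ℤ} (hx : x ∈ L)
    (hxX : x ∉ X) :
    ((swapCols σ S (insert x X)).erase (σ x)).erase (-σ x) =
      ((swapCols σ S X).erase x).erase (-x) := by
  have h0 := h.pos hx
  have hl := h.lt x hx
  have hx1 := h.notMem_image_of_mem hX hx
  have hx2 := h.image_mem_image_iff hX hx
  have hx3 := h.undotted x hx
  have hneg : ∀ y ∈ L, -y ∉ X := fun y hy h' => by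
    have := h.pos hy
    have := h.pos (hX h')
    omega
  have hx4 : -x ∉ X.image σ := fun h' => by have := h.image_pos hX _ h'; omega
  have hx5 : -σ x ∉ X.image σ := fun h' => by have := h.image_pos hX _ h'; omega
  ext a
  simp only [swapCols, Finset.mem_erase, Finset.mem_union, Finset.mem_sdiff, mem_pmSet,
    Finset.mem_insert, Finset.image_insert]
  by_cases h1 : a = σ x
  · subst h1; simp [hx2, hx3, hxX, hx5]
  · by_cases h2 : a = -σ x
    · subst h2; simp [hx2, hx3, hxX, hx5]
    · by_cases h3 : a = x
      · subst h3; simp [hx1, hx4]; omega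
      · by_cases h4 : a = -x
        · subst h4; simp [hx1, hx4]; omega
        · have h5 : -a ≠ x := by omega
          have h6 : -a ≠ σ x := by omega
          simp [h1, h2, h3, h4, h5, h6]

/-- The kernel vector attached to a complete matching. -/
theorem Fop_sum_eq_zero (h : IsMatching n S σ L) (hS : S ⊆ Iset n) :
    Fop n (∑ X ∈ L.powerset, (qv ^ (-(X.card : ℤ))) • vS n (swapCols σ S X)) = 0 := by
  rw [map_sum]
  have e : ∀ X ∈ L.powerset, Fop n ((qv ^ (-(X.card : ℤ))) • vS n (swapCols σ S X)) =
      ∑ x ∈ L, (qv ^ (-(X.card : ℤ))) •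
        removeTerm n (swapCols σ S X) (if x ∈ X then σ x else x) := by
    intro X hX
    rw [Finset.mem_powerset] at hX
    rw [map_smul, Fop_vS (h.swapCols_subset hS hX), h.FAct_swapCols hX, Finset.smul_sum]
  rw [Finset.sum_congr rfl e, Finset.sum_comm]
  refine Finset.sum_eq_zero fun x hx => ?_
  rw [← Finset.insert_erase hx, Finset.sum_powerset_insert (Finset.notMem_erase x L),
    ← Finset.sum_add_distrib]
  refine Finset.sum_eq_zero fun X hX => ?_
  rw [Finset.mem_powerset] at hX
  have hxX : x ∉ X := fun h' => Finset.notMem_erase x L (hX h')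
  have hXL : X ⊆ L := hX.trans (Finset.erase_subset _ _)
  rw [if_neg hxX, if_pos (Finset.mem_insert_self _ _), removeTerm, removeTerm,
    h.wLt_swapCols_insert hXL hx, h.erase_swapCols_insert hXL hx hxX, smul_smul, smul_smul,
    ← add_smul, Finset.card_insert_of_notMem hxX]
  have hq := qv_ne_zero
  have : qv ^ (-(X.card : ℤ)) * (-qv) ^ wLt n x (swapCols σ S X) +
      qv ^ (-((X.card + 1 : ℕ) : ℤ)) * (-qv) ^ (wLt n x (swapCols σ S X) + 1) = 0 := by
    rw [zpow_add_one₀ (neg_ne_zero.2 hq), Nat.cast_succ, neg_add, zpow_add₀ hq, zpow_neg_one]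
    field_simp
    ring
  rw [this, zero_smul]

end IsMatching

lemma Fop_bvecL {n : ℕ} {S : Finset ℤ} (hS : S ⊆ Iset n) (h : unmatchedCount n S = 0) :
    Fop n (bvecL n S) = 0 :=
  (isMatching_matchCol h).Fop_sum_eq_zero hS

lemma vS_apply {n : ℕ} {T : Finset ℤ} (P : Bset n) : vS n T P = if T = P.1 then 1 else 0 := by
  by_cases h : T ⊆ Iset n
  · simp only [vS_of_subset h, Finsupp.single_apply, Subtype.ext_iff]
  · rw [vS, dif_neg h, if_neg (by rintro rfl; exact h P.2)]; rfl

lemma bvecL_apply {n : ℕ} (S : Finset ℤ) (P : Bset n) : bvecL n S P =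
    ∑ X ∈ (LSet n S).powerset,
      (qv ^ (-(X.card : ℤ))) * if swapCols (matchCol n S) S X = P.1 then 1 else 0 := by
  rw [bvecL_eq, Finsupp.finsetSum_apply]
  exact Finset.sum_congr rfl fun X _ => by rw [Finsupp.smul_apply, vS_apply, smul_eq_mul]

lemma qv_zpow_mem (m : ℤ) : qv ^ m ∈ Asub := by
  have h1 : qv ∈ Asub := Subring.subset_closure (by simp)
  have h2 : qv⁻¹ ∈ Asub := Subring.subset_closure (by simp)
  cases m with
  | ofNat m => simpa using Subring.pow_mem _ h1 m
  | negSucc m =>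
    rw [zpow_negSucc, ← inv_pow]
    exact Subring.pow_mem _ h2 _

lemma bvecL_apply_mem {n : ℕ} (S : Finset ℤ) (P : Bset n) : bvecL n S P ∈ Asub := by
  rw [bvecL_apply]
  refine Subring.sum_mem _ fun X _ => Subring.mul_mem _ (qv_zpow_mem _) ?_
  split_ifs
  exacts [Subring.one_mem _, Subring.zero_mem _]

lemma mem_LamA_iff {n : ℕ} {x : Lam n} : x ∈ LamA n ↔ ∀ P, x P ∈ Asub := by
  have key : ∀ c : Bset n →₀ Fq, c.sum (fun S a => a • bv n S) = c := fun c => by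
    simp [bv]
  constructor
  · rintro ⟨c, hc, rfl⟩
    rwa [key]
  · intro h
    exact ⟨x, h, (key x).symm⟩

lemma apply_eq_zero_of_mem_Lk {n k : ℕ} {x : Lam n} (hx : x ∈ Lk n k) (P : Bset n)
    (hP : P.1.card ≠ k) : x P = 0 := by
  induction hx using Submodule.span_induction with
  | mem x hx =>
    obtain ⟨S, hS, rfl⟩ := hx
    rw [bv, Finsupp.single_apply, if_neg (by rintro rfl; exact hP hS)]
  | zero => rfl
  | add x y _ _ h1 h2 => rw [Finsupp.add_apply, h1, h2, add_zero]
  | smul a x _ h => rw [Finsupp.smul_apply, h, smul_zero]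

lemma bvecL_mem_Lk {n k : ℕ} {S : Finset ℤ} (hS : S ∈ goodSets n k) : bvecL n S ∈ Lk n k := by
  obtain ⟨h1, h2, h3⟩ := mem_goodSets.1 hS
  have hm := isMatching_matchCol h3
  rw [bvecL_eq]
  refine Submodule.sum_mem _ fun X hX => Submodule.smul_mem _ _ (Submodule.subset_span ?_)
  rw [Finset.mem_powerset] at hX
  exact ⟨⟨_, hm.swapCols_subset h1 hX⟩, (hm.card_swapCols hX).trans h2,
    vS_of_subset (hm.swapCols_subset h1 hX)⟩

lemma bvecL_apply_of_le {n : ℕ} {S : Finset ℤ} (h : unmatchedCount n S = 0) (P : Bset n)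
    (hP : ∑ a ∈ P.1, a.natAbs ≤ ∑ a ∈ S, a.natAbs) :
    bvecL n S P = if S = P.1 then 1 else 0 := by
  rw [bvecL_apply, Finset.sum_eq_single ∅]
  · simp [swapCols, pmSet, negSet]
  · intro X hX hne
    have := (isMatching_matchCol h).sum_natAbs_lt (Finset.mem_powerset.1 hX)
      (Finset.nonempty_iff_ne_empty.2 hne)
    rw [if_neg, mul_zero]
    intro he
    rw [he] at this
    omega
  · intro h'; exact absurd (Finset.empty_mem_powerset _) h'

/-- The coordinate function of an element of `Λ`. -/
def coordFun (n : ℕ) : Lam n →ₗ[Fq] (Finset ℤ → Fq) where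
  toFun x P := if h : P ⊆ Iset n then x ⟨P, h⟩ else 0
  map_add' x y := by ext P; by_cases h : P ⊆ Iset n <;> simp [h]
  map_smul' c x := by ext P; by_cases h : P ⊆ Iset n <;> simp [h]

lemma coordFun_apply {n : ℕ} (x : Lam n) (P : Finset ℤ) :
    coordFun n x P = if h : P ⊆ Iset n then x ⟨P, h⟩ else 0 := rfl

lemma coordFun_vS {n : ℕ} {T : Finset ℤ} (hT : T ⊆ Iset n) (P : Finset ℤ) :
    coordFun n (vS n T) P = if T = P then 1 else 0 := by
  rw [coordFun_apply]
  split_ifs with h1 h2 h2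
  · rw [vS_apply, if_pos h2]
  · rw [vS_apply, if_neg h2]
  · exact absurd (h2 ▸ hT) h1
  · rfl

lemma coordFun_FAct {n : ℕ} {S : Finset ℤ} (hS : S ⊆ Iset n) :
    coordFun n (FAct n S) = lower n (coordFun n (vS n S)) := by
  ext P
  rw [FAct, map_sum, Finset.sum_apply, lower, LinearMap.sum_apply, Finset.sum_apply,
    Finset.sum_filter]
  symm
  refine Finset.sum_nbij' (fun j : ℕ => (j + 1 : ℤ)) (fun j => (j - 1).toNat) ?_ ?_ ?_ ?_ ?_
  any_goals
    intro j hj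
    simp only [Finset.mem_range, Finset.mem_Icc] at hj ⊢
    omega
  intro i hi
  rw [Finset.mem_range] at hi
  have h0 : (i + 1 : ℤ) ≤ n := by omega
  simp only [colLower_apply, coordFun_vS hS, mem_Szero, neg_neg]
  have hiff : (((i + 1 : ℤ) ∉ P ∧ -(i + 1 : ℤ) ∉ P) ∧ S = fillCol P (i + 1)) ↔
      (((i + 1 : ℤ) ∈ S ∧ -(i + 1 : ℤ) ∈ S) ∧ (S.erase (i + 1 : ℤ)).erase (-(i + 1 : ℤ)) = P) := by
    constructor
    · rintro ⟨⟨h1, h2⟩, rfl⟩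
      refine ⟨⟨by simp [mem_fillCol], by simp [mem_fillCol]⟩, ?_⟩
      ext a
      simp only [Finset.mem_erase, mem_fillCol]
      constructor
      · tauto
      · intro h
        exact ⟨fun h' => h2 (h' ▸ h), fun h' => h1 (h' ▸ h), Or.inr (Or.inr h)⟩
    · rintro ⟨⟨h1, h2⟩, rfl⟩
      refine ⟨by simp, ?_⟩
      ext a
      simp only [Finset.mem_erase, mem_fillCol]
      constructor
      · tauto
      · rintro (rfl | rfl | h)
        exacts [h1, h2, h.2.2]
  by_cases hA : ((i + 1 : ℤ) ∉ P ∧ -(i + 1 : ℤ) ∉ P) ∧ S = fillCol P (i + 1)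
  · have hB := hiff.1 hA
    have hsub : (S.erase (i + 1 : ℤ)).erase (-(i + 1 : ℤ)) ⊆ Iset n :=
      ((Finset.erase_subset _ _).trans (Finset.erase_subset _ _)).trans hS
    rw [if_pos hA.1, if_pos hA.2, if_pos ⟨hB.1, hB.1.symm⟩, map_smul, Pi.smul_apply,
      coordFun_vS hsub, if_pos hB.2, wLt_eq h0, sum_Ioo_eq_colWeight, hA.2,
      colWeight_fillCol_of_le le_rfl, smul_eq_mul]
  · have hB := fun h => hA (hiff.2 h)
    trans 0
    · by_cases h1 : (i + 1 : ℤ) ∉ P ∧ -(i + 1 : ℤ) ∉ P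
      · rw [if_pos h1, if_neg fun h2 => hA ⟨h1, h2⟩, mul_zero]
      · rw [if_neg h1]
    · by_cases h1 : (i + 1 : ℤ) ∈ S ∧ -(i + 1 : ℤ) ∈ S
      · have hsub : (S.erase (i + 1 : ℤ)).erase (-(i + 1 : ℤ)) ⊆ Iset n :=
          ((Finset.erase_subset _ _).trans (Finset.erase_subset _ _)).trans hS
        rw [if_pos ⟨h1, h1.symm⟩, map_smul, Pi.smul_apply, coordFun_vS hsub,
          if_neg fun h2 => hB ⟨h1, h2⟩, smul_zero]
      · rw [if_neg fun h => h1 h.1]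

lemma coordFun_Fop {n : ℕ} (x : Lam n) : coordFun n (Fop n x) = lower n (coordFun n x) := by
  have : (coordFun n).comp (Fop n) = (lower n).comp (coordFun n) := by
    refine Finsupp.lhom_ext' fun S => LinearMap.ext_ring ?_
    have h := vS_of_subset S.2
    have : coordFun n (Fop n (vS n S.1)) = lower n (coordFun n (vS n S.1)) := by
      rw [Fop_vS S.2, coordFun_FAct S.2]
    rw [h] at this
    exact this
  exact LinearMap.congr_fun this x

/-- An element of `ker F` is determined by its coordinates at the completely matched sets. -/
lemma eq_zero_of_Fop_eq_zero {n : ℕ} {x : Lam n} (hx : Fop n x = 0)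
    (h0 : ∀ P : Bset n, unmatchedCount n P.1 = 0 → x P = 0) : x = 0 := by
  have h : coordFun n x = 0 := by
    refine eq_zero_of_lower_pow_eq_zero n 1 _ ?_ fun P hP => ?_
    · rw [pow_one, ← coordFun_Fop, hx, map_zero]
    · rw [coordFun_apply]
      split_ifs with h
      · exact h0 ⟨P, h⟩ (Nat.lt_one_iff.1 hP)
      · rfl
  ext P
  have := congrFun h P.1
  rwa [coordFun_apply, dif_pos P.2] at this

/-- The number of `k`-element subsets of `I` with fewer than `m` unmatched columns. -/
def unmatchedLtCount (n : ℕ) (k : ℤ) (m : ℕ) : ℕ :=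
  ((Iset n).powerset.filter fun S => (S.card : ℤ) = k ∧ unmatchedCount n S < m).card

/-- The binomial coefficient with integral lower index. -/
def intChoose (N : ℕ) (k : ℤ) : ℤ := if 0 ≤ k then (N.choose k.toNat : ℤ) else 0

lemma intChoose_succ (N : ℕ) (k : ℤ) :
    intChoose (N + 1) k = intChoose N k + intChoose N (k - 1) := by
  unfold intChoose
  rcases lt_trichotomy k 0 with h | rfl | h
  · rw [if_neg (by omega), if_neg (by omega), if_neg (by omega), add_zero]
  · simp
  · obtain ⟨r, rfl⟩ : ∃ r : ℕ, k = r + 1 := ⟨(k - 1).toNat, by omega⟩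
    have e1 : ((r : ℤ) + 1).toNat = r + 1 := by omega
    have e2 : ((r : ℤ) + 1 - 1).toNat = r := by omega
    rw [if_pos (by omega), if_pos (by omega), if_pos (by omega), e1, e2, Nat.choose_succ_succ]
    push_cast
    ring

lemma Iset_succ (n : ℕ) :
    Iset (n + 1) = insert (n + 1 : ℤ) (insert (-(n + 1 : ℤ)) (Iset n)) := by
  ext a
  simp only [Finset.mem_insert, mem_Iset]
  push_cast
  omega

lemma unmatchedLtCount_succ (n : ℕ) (k : ℤ) (m : ℕ) :
    unmatchedLtCount (n + 1) k (m + 1) = unmatchedLtCount n k (m + 2) +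
      2 * unmatchedLtCount n (k - 1) (m + 1) + unmatchedLtCount n (k - 2) m := by
  have hb : -(n + 1 : ℤ) ∉ Iset n := by rw [mem_Iset]; omega
  have ha : (n + 1 : ℤ) ∉ insert (-(n + 1 : ℤ)) (Iset n) := by
    rw [Finset.mem_insert, mem_Iset]; omega
  simp only [unmatchedLtCount, Finset.card_filter]
  rw [Iset_succ, Finset.sum_powerset_insert ha, Finset.sum_powerset_insert hb,
    Finset.sum_powerset_insert hb, two_mul, ← Finset.sum_add_distrib, ← Finset.sum_add_distrib,
    ← Finset.sum_add_distrib, ← Finset.sum_add_distrib, ← Finset.sum_add_distrib,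
    ← Finset.sum_add_distrib]
  refine Finset.sum_congr rfl fun S hS => ?_
  rw [Finset.mem_powerset] at hS
  have h1 : (n + 1 : ℤ) ∉ S := fun h => ha (Finset.mem_insert_of_mem (hS h))
  have h2 : -(n + 1 : ℤ) ∉ S := fun h => hb (hS h)
  have h3 : (n + 1 : ℤ) ∉ insert (-(n + 1 : ℤ)) S := by
    rw [Finset.mem_insert, not_or]; exact ⟨by omega, h1⟩
  have h4 : -(n + 1 : ℤ) ∉ insert (n + 1 : ℤ) S := by
    rw [Finset.mem_insert, not_or]; exact ⟨by omega, h2⟩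
  have u1 : unmatchedCount n (insert (n + 1 : ℤ) S) = unmatchedCount n S :=
    unmatchedCount_congr fun a _ h => by
      rw [abs_le] at h
      rw [Finset.mem_insert]
      exact ⟨fun h' => h'.resolve_left (by omega), Or.inr⟩
  have u2 : ∀ S : Finset ℤ,
      unmatchedCount n (insert (-(n + 1 : ℤ)) S) = unmatchedCount n S := fun S =>
    unmatchedCount_congr fun a _ h => by
      rw [abs_le] at h
      rw [Finset.mem_insert]
      exact ⟨fun h' => h'.resolve_left (by omega), Or.inr⟩
  have u3 : unmatchedCount n (insert (n + 1 : ℤ) (insert (-(n + 1 : ℤ)) S)) =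
      unmatchedCount n S := unmatchedCount_fillCol n S
  have v0 : unmatchedCount (n + 1) S = unmatchedCount n S - 1 := by
    rw [unmatchedCount, if_neg fun h => h1 h.1, if_pos ⟨h1, h2⟩]
  have v1 : unmatchedCount (n + 1) (insert (n + 1 : ℤ) S) = unmatchedCount n S := by
    rw [unmatchedCount, if_neg fun h => h4 h.2,
      if_neg fun h => h.1 (Finset.mem_insert_self _ _), u1]
  have v2 : unmatchedCount (n + 1) (insert (-(n + 1 : ℤ)) S) = unmatchedCount n S := by
    rw [unmatchedCount, if_neg fun h => h3 h.1,
      if_neg fun h => h.2 (Finset.mem_insert_self _ _), u2]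
  have v3 : unmatchedCount (n + 1) (insert (n + 1 : ℤ) (insert (-(n + 1 : ℤ)) S)) =
      unmatchedCount n S + 1 := by
    rw [unmatchedCount, if_pos (by simp), u3]
  rw [v0, v1, v2, v3, Finset.card_insert_of_notMem h1, Finset.card_insert_of_notMem h3,
    Finset.card_insert_of_notMem h2]
  push_cast
  have e0 : ((S.card : ℤ) = k ∧ unmatchedCount n S - 1 < m + 1) ↔
    ((S.card : ℤ) = k ∧ unmatchedCount n S < m + 2) := by omega
  have e1 : ((S.card : ℤ) + 1 = k ∧ unmatchedCount n S < m + 1) ↔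
    ((S.card : ℤ) = k - 1 ∧ unmatchedCount n S < m + 1) := by omega
  have e2 : ((S.card : ℤ) + 1 + 1 = k ∧ unmatchedCount n S + 1 < m + 1) ↔
    ((S.card : ℤ) = k - 2 ∧ unmatchedCount n S < m) := by omega
  simp only [e0, e1, e2]
  ring

lemma unmatchedLtCount_eq (n : ℕ) (k : ℤ) (m : ℕ) (h : k ≤ n + m) :
    (unmatchedLtCount n k m : ℤ) = intChoose (2 * n) k - intChoose (2 * n) (k - 2 * m) := by
  induction n generalizing k m with
  | zero =>
    have hI : Iset 0 = ∅ := by simp [Iset]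
    cases m with
    | zero => simp [unmatchedLtCount]
    | succ m =>
      have h1 : intChoose (2 * 0) (k - 2 * (m + 1 : ℕ)) = 0 := if_neg (by push_cast at h ⊢; omega)
      rw [h1, sub_zero]
      rcases eq_or_ne k 0 with rfl | hk
      · simp [unmatchedLtCount, hI, Finset.filter_singleton, unmatchedCount, intChoose]
      · have h2 : unmatchedLtCount 0 k (m + 1) = 0 := by
          rw [unmatchedLtCount, hI, Finset.powerset_empty, Finset.card_eq_zero,
            Finset.filter_eq_empty_iff]
          rintro S hS ⟨hS', -⟩
          rw [Finset.mem_singleton.1 hS] at hS'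
          exact hk hS'.symm
        rw [h2, intChoose]
        split_ifs with h3
        · rw [Nat.choose_eq_zero_of_lt (by omega)]
        · rfl
  | succ n ih =>
    cases m with
    | zero => simp [unmatchedLtCount]
    | succ m =>
      push_cast at h
      have i1 := ih k (m + 2) (by push_cast; omega)
      have i2 := ih (k - 1) (m + 1) (by push_cast; omega)
      have i3 := ih (k - 2) m (by omega)
      rw [unmatchedLtCount_succ]
      push_cast at i1 i2 i3 ⊢
      have e0 : 2 * (n + 1) = 2 * n + 1 + 1 := by ring
      rw [i1, i2, i3, e0]
      simp only [intChoose_succ]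
      have e1 : k - 1 - 1 = k - 2 := by ring
      have e2 : k - 1 - 2 * ((m : ℤ) + 1) = k - 2 * (m + 1) - 1 := by ring
      have e3 : k - 2 * ((m : ℤ) + 2) = k - 2 * (m + 1) - 1 - 1 := by ring
      have e4 : k - 2 - 2 * (m : ℤ) = k - 2 * (m + 1) := by ring
      rw [e1, e2, e3, e4]
      ring

lemma card_goodSets {n k : ℕ} (hk : k ≤ n) :
    (goodSets n k).card =
      Nat.choose (2 * n) k - (if 2 ≤ k then Nat.choose (2 * n) (k - 2) else 0) := by
  have h1 : goodSets n k =
      (Iset n).powerset.filter fun S => (S.card : ℤ) = k ∧ unmatchedCount n S < 1 := by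
    ext S
    rw [mem_goodSets, Finset.mem_filter, Finset.mem_powerset, Nat.lt_one_iff, Nat.cast_inj]
  have h2 := unmatchedLtCount_eq n k 1 (by push_cast; omega)
  rw [unmatchedLtCount, ← h1, intChoose, intChoose, if_pos (by omega), Int.toNat_natCast] at h2
  split_ifs at h2 ⊢ with h3 h4 h4
  · have e : ((k : ℤ) - 2 * (1 : ℕ)).toNat = k - 2 := by omega
    rw [e] at h2
    omega
  · omega
  · omega
  · omega

lemma exists_bvecL_expansion {n k : ℕ} (d : ℕ) (x : Lam n) (hF : Fop n x = 0)
    (hA : ∀ P, x P ∈ Asub) (hk : ∀ P : Bset n, P.1.card ≠ k → x P = 0)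
    (h0 : ∀ P : Bset n, P.1 ∈ goodSets n k →
      ∑ a ∈ P.1, a.natAbs + d ≤ ∑ a ∈ Iset n, a.natAbs → x P = 0) :
    ∃ c : Finset ℤ →₀ Fq, (∀ T, c T ∈ Asub) ∧ (∀ T, c T ≠ 0 → T ∈ goodSets n k) ∧
      x = c.sum (fun T a => a • bvecL n T) := by
  induction d generalizing x with
  | zero =>
    refine ⟨0, fun _ => Subring.zero_mem _, fun _ h => absurd rfl h, ?_⟩
    rw [Finsupp.sum_zero_index]
    refine eq_zero_of_Fop_eq_zero hF fun P hP => ?_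
    by_cases hPk : P.1.card = k
    · exact h0 P (mem_goodSets.2 ⟨P.2, hPk, hP⟩) (Finset.sum_le_sum_of_subset P.2)
    · exact hk P hPk
  | succ d ih =>
    let N := ∑ a ∈ Iset n, a.natAbs
    let G := (goodSets n k).filter fun T => ∑ a ∈ T, a.natAbs + d = N
    let c₀ : Finset ℤ →₀ Fq := Finsupp.onFinset G
      (fun T => if T ∈ G then coordFun n x T else 0) fun T h => by
        by_contra h'; exact h (if_neg h')
    have hc₀ : ∀ T, c₀ T = if T ∈ G then coordFun n x T else 0 := fun T => rfl
    have hc₀G : ∀ T, c₀ T ≠ 0 → T ∈ G := fun T h => by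
      by_contra h'; exact h (by rw [hc₀, if_neg h'])
    have hc₀A : ∀ T, c₀ T ∈ Asub := fun T => by
      rw [hc₀, coordFun_apply]
      split_ifs
      exacts [hA _, Subring.zero_mem _, Subring.zero_mem _]
    have hgood : ∀ T ∈ c₀.support, T ∈ goodSets n k := fun T hT =>
      (Finset.mem_filter.1 (hc₀G T (Finsupp.mem_support_iff.1 hT))).1
    set y := c₀.sum fun T a => a • bvecL n T with hy
    have yF : Fop n y = 0 := by
      rw [hy, Finsupp.sum, map_sum]
      refine Finset.sum_eq_zero fun T hT => ?_
      have := mem_goodSets.1 (hgood T hT)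
      rw [map_smul, Fop_bvecL this.1 this.2.2, smul_zero]
    have yapp : ∀ P, y P = ∑ T ∈ c₀.support, c₀ T * bvecL n T P := fun P => by
      rw [hy, Finsupp.sum, Finsupp.finsetSum_apply]; rfl
    have yA : ∀ P, y P ∈ Asub := fun P => by
      rw [yapp]
      exact Subring.sum_mem _ fun T _ => Subring.mul_mem _ (hc₀A T) (bvecL_apply_mem T P)
    have yk : ∀ P : Bset n, P.1.card ≠ k → y P = 0 := fun P hP => by
      rw [yapp]
      refine Finset.sum_eq_zero fun T hT => ?_
      rw [apply_eq_zero_of_mem_Lk (bvecL_mem_Lk (hgood T hT)) P hP, mul_zero]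
    have y0 : ∀ P : Bset n, ∑ a ∈ P.1, a.natAbs + d ≤ N → y P = c₀ P.1 := fun P hP => by
      have : ∀ T ∈ c₀.support, c₀ T * bvecL n T P = if T = P.1 then c₀ T else 0 := by
        intro T hT
        have hTG := Finset.mem_filter.1 (hc₀G T (Finsupp.mem_support_iff.1 hT))
        rw [bvecL_apply_of_le (mem_goodSets.1 hTG.1).2.2 P (by omega), mul_ite, mul_one, mul_zero]
      rw [yapp, Finset.sum_congr rfl this, Finset.sum_ite_eq']
      split_ifs with h
      · rfl
      · exact (Finsupp.notMem_support_iff.1 h).symm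
    obtain ⟨c, h1, h2, h3⟩ := ih (x - y) (by rw [map_sub, hF, yF, sub_zero])
      (fun P => by rw [Finsupp.sub_apply]; exact Subring.sub_mem _ (hA P) (yA P))
      (fun P hP => by rw [Finsupp.sub_apply, hk P hP, yk P hP, sub_zero])
      (fun P hPg hP => by
        rw [Finsupp.sub_apply, y0 P hP, hc₀]
        split_ifs with h
        · rw [coordFun_apply, dif_pos P.2, sub_self]
        · rw [sub_zero]
          refine h0 P hPg ?_
          have : ∑ a ∈ P.1, a.natAbs + d ≠ N := fun h' => h (Finset.mem_filter.2 ⟨hPg, h'⟩)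
          change _ ≤ N
          change _ ≤ N at hP
          omega)
    refine ⟨c + c₀, fun T => Subring.add_mem _ (h1 T) (hc₀A T), fun T hT => ?_, ?_⟩
    · by_cases hT' : c T = 0
      · refine hgood T (Finsupp.mem_support_iff.2 fun h => hT ?_)
        rw [Finsupp.add_apply, hT', h, add_zero]
      · exact h2 T hT'
    · have hadd : (c + c₀).sum (fun T a => a • bvecL n T) = c.sum (fun T a => a • bvecL n T) + y :=
        Finsupp.sum_add_index' (h := fun T a => a • bvecL n T) (fun _ => zero_smul _ _)
          fun _ _ _ => add_smul _ _ _
      rw [hadd, ← h3, sub_add_cancel]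

lemma eq_zero_of_sum_bvecL_eq_zero {n k : ℕ} (c : Finset ℤ →₀ Fq)
    (hc : ∀ T, c T ≠ 0 → T ∈ goodSets n k) (h : c.sum (fun T a => a • bvecL n T) = 0) : c = 0 := by
  by_contra hne
  obtain ⟨T, hT, hmin⟩ := Finset.exists_min_image c.support (fun T => ∑ a ∈ T, a.natAbs)
    (Finsupp.support_nonempty_iff.2 hne)
  have hg := fun S (hS : S ∈ c.support) => mem_goodSets.1 (hc S (Finsupp.mem_support_iff.1 hS))
  have h1 := DFunLike.congr_fun h (⟨T, (hg T hT).1⟩ : Bset n)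
  have h2 : ∀ S ∈ c.support, (c S • bvecL n S) (⟨T, (hg T hT).1⟩ : Bset n) =
      if S = T then c S else 0 := by
    intro S hS
    rw [Finsupp.smul_apply, bvecL_apply_of_le (hg S hS).2.2 _ (hmin S hS), smul_eq_mul, mul_ite,
      mul_one, mul_zero]
  rw [Finsupp.sum, Finsupp.finsetSum_apply, Finset.sum_congr rfl h2, Finset.sum_ite_eq',
    if_pos hT] at h1
  exact Finsupp.mem_support_iff.1 hT h1


/-- {b_S : S ∈ goodSets} is an A-basis of ker(F) ∩ Λ_A^k; in particular this
module is free over A of rank binom(2n,k) − binom(2n,k−2). -/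
theorem stmt8 (n : ℕ) (hn : 1 ≤ n) (k : ℕ) (hk : k ≤ n) :
    (∀ T ∈ goodSets n k, Fop n (bvecL n T) = 0 ∧ bvecL n T ∈ LamA n ∧ bvecL n T ∈ Lk n k) ∧
    (∀ x : Lam n, Fop n x = 0 → x ∈ LamA n → x ∈ Lk n k →
      ∃ c : Finset ℤ →₀ Fq, (∀ T, c T ∈ Asub) ∧ (∀ T, c T ≠ 0 → T ∈ goodSets n k) ∧
        x = c.sum (fun T a => a • bvecL n T)) ∧
    (∀ c : Finset ℤ →₀ Fq, (∀ T, c T ∈ Asub) → (∀ T, c T ≠ 0 → T ∈ goodSets n k) →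
      c.sum (fun T a => a • bvecL n T) = 0 → c = 0) ∧
    (goodSets n k).card =
      Nat.choose (2 * n) k - (if 2 ≤ k then Nat.choose (2 * n) (k - 2) else 0) := by
  refine ⟨fun T hT => ⟨Fop_bvecL (mem_goodSets.1 hT).1 (mem_goodSets.1 hT).2.2,
    mem_LamA_iff.2 (bvecL_apply_mem T), bvecL_mem_Lk hT⟩, fun x hF hA hL => ?_,
    fun c _ hc h => eq_zero_of_sum_bvecL_eq_zero c hc h, card_goodSets hk⟩
  exact exists_bvecL_expansion (∑ a ∈ Iset n, a.natAbs + 1) x hF (mem_LamA_iff.1 hA)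
    (apply_eq_zero_of_mem_Lk hL) fun P _ h => absurd h (by omega)
end
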